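/- Let T and T′ be triangulations of the completed ∞-gon such that there exists a T-admissible composition of completed mutations Θ with μ_Θ(T) = T′. If β is a T′-admissible sequence with μ̄_β(T′) = T″, then there exists a T-admissible composition of completed mutations Γ with μ_Γ(T) = T″. -/

import Mathlib

open scoped Classical

/-- Vertices of the completed ∞-gon: `ℤ ∪ {−∞, +∞}` with the extended linear order. -/
abbrev Vtx : Type := WithBot (WithTop ℤ)

/-- The vertex corresponding to an integer. -/
def vInt (m : ℤ) : Vtx := ((m : WithTop ℤ) : Vtx)

/-- The vertex `+∞`. -/
def vTop : Vtx := ((⊤ : WithTop ℤ) : Vtx)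

/-- The vertex `−∞`. -/
def vBot : Vtx := (⊥ : Vtx)

/-- An arc of the completed ∞-gon: a pair of vertices `src < tgt` such that if both
endpoints are integers then they differ by at least `2`. -/
structure Arc where
  src : Vtx
  tgt : Vtx
  lt : src < tgt
  sep : ∀ m n : ℤ, src = vInt m → tgt = vInt n → m + 2 ≤ n

/-- Two arcs `(a,b)` and `(c,d)` cross if `a < c < b < d` or `c < a < d < b`. -/
def Cross (x y : Arc) : Prop :=
  (x.src < y.src ∧ y.src < x.tgt ∧ x.tgt < y.tgt) ∨
  (y.src < x.src ∧ x.src < y.tgt ∧ y.tgt < x.tgt)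

/-- A triangulation of the completed ∞-gon: a maximal set of pairwise compatible
(= non-crossing) arcs. -/
def IsTriangulation (T : Set Arc) : Prop :=
  (∀ x ∈ T, ∀ y ∈ T, ¬ Cross x y) ∧
  ∀ γ : Arc, (∀ x ∈ T, ¬ Cross γ x) → γ ∈ T

lemma vInt_lt_vTop (m : ℤ) : vInt m < vTop := by
  simpa [vInt, vTop] using WithBot.coe_lt_coe.mpr (WithTop.coe_lt_top (m : ℤ))

lemma vBot_lt_vInt (m : ℤ) : vBot < vInt m := WithBot.bot_lt_coe _

lemma vBot_lt_vTop : vBot < vTop := WithBot.bot_lt_coe _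

lemma vTop_ne_vInt (n : ℤ) : vTop ≠ vInt n := by simp [vTop, vInt]

lemma vBot_ne_vInt (n : ℤ) : vBot ≠ vInt n := by simp [vBot, vInt]

/-- The Prüfer curve `π_m = (m, +∞)`. -/
def prufer (m : ℤ) : Arc :=
  ⟨vInt m, vTop, vInt_lt_vTop m, fun _ n _ h => absurd h (vTop_ne_vInt n)⟩

/-- The adic curve `α_m = (−∞, m)`. -/
def adic (m : ℤ) : Arc :=
  ⟨vBot, vInt m, vBot_lt_vInt m, fun k _ h _ => absurd h (vBot_ne_vInt k)⟩

/-- The generic curve `z = (−∞, +∞)`. -/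
def generic : Arc :=
  ⟨vBot, vTop, vBot_lt_vTop, fun k _ h _ => absurd h (vBot_ne_vInt k)⟩

/-- `T` contains an arc with endpoints `x` and `y`. -/
def HasArc (T : Set Arc) (x y : Vtx) : Prop := ∃ γ ∈ T, γ.src = x ∧ γ.tgt = y

/-- `T` has a right fountain at the integer `n`. -/
def RightFountainInt (T : Set Arc) (n : ℤ) : Prop :=
  {p : ℤ | HasArc T (vInt n) (vInt p)}.Infinite

/-- `T` has a left fountain at the integer `n`. -/
def LeftFountainInt (T : Set Arc) (n : ℤ) : Prop :=
  {p : ℤ | HasArc T (vInt p) (vInt n)}.Infinite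

/-- `T` has a right fountain at the vertex `v`. -/
def RightFountain (T : Set Arc) (v : Vtx) : Prop :=
  (∃ n : ℤ, v = vInt n ∧ RightFountainInt T n) ∨
  (v = vTop ∧ {p : ℤ | 0 ≤ p ∧ prufer p ∈ T}.Infinite) ∨
  (v = vBot ∧ {p : ℤ | 0 ≤ p ∧ adic p ∈ T}.Infinite)

/-- `T` has a left fountain at the vertex `v`. -/
def LeftFountain (T : Set Arc) (v : Vtx) : Prop :=
  (∃ n : ℤ, v = vInt n ∧ LeftFountainInt T n) ∨
  (v = vTop ∧ {p : ℤ | p ≤ 0 ∧ prufer p ∈ T}.Infinite) ∨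
  (v = vBot ∧ {p : ℤ | p ≤ 0 ∧ adic p ∈ T}.Infinite)

/-- `T` is locally finite if every vertex is an endpoint of only finitely many arcs of `T`. -/
def LocallyFin (T : Set Arc) : Prop :=
  ∀ v : Vtx, {γ | γ ∈ T ∧ (γ.src = v ∨ γ.tgt = v)}.Finite

/-- An arc is peripheral if both endpoints are integers. -/
def IsPeripheral (γ : Arc) : Prop :=
  (∃ m : ℤ, γ.src = vInt m) ∧ ∃ n : ℤ, γ.tgt = vInt n

/-- `γ'` is an exchange partner for `γ` relative to `T`:
it is distinct from `γ` and `(T \ {γ}) ∪ {γ'}` is again a triangulation. -/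
def MutExchange (T : Set Arc) (γ γ' : Arc) : Prop :=
  γ' ≠ γ ∧ IsTriangulation ((T \ {γ}) ∪ {γ'})

/-- `γ` is a mutable arc of `T`. -/
def IsMutable (T : Set Arc) (γ : Arc) : Prop :=
  γ ∈ T ∧ ∃ γ', MutExchange T γ γ'

/-- The (unique) replacement arc of `γ` in `T`, when `γ` is mutable. -/
noncomputable def flipArc (T : Set Arc) (γ : Arc) : Arc :=
  if h : ∃ γ', MutExchange T γ γ' then h.choose else γ

/-- The mutation `μ_γ(T)` of `T` at `γ`. -/
noncomputable def mutate (T : Set Arc) (γ : Arc) : Set Arc :=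
  (T \ {γ}) ∪ {flipArc T γ}

/-- `μ_γ(δ)`: the effect of the mutation of `T` at `γ` on the arc `δ`. -/
noncomputable def mutArc (T : Set Arc) (γ δ : Arc) : Arc :=
  if δ = γ then flipArc T γ else δ

/-- One step of a mutation sequence on a set of arcs (`none` = no entry). -/
noncomputable def stepT (T : Set Arc) : Option Arc → Set Arc
  | none => T
  | some γ => mutate T γ

/-- One step of a mutation sequence on a single arc. -/
noncomputable def stepA (T : Set Arc) : Option Arc → Arc → Arc
  | none, δ => δ
  | some γ, δ => mutArc T γ δ

/-- `iterT T θ k` is `μ_{θ_k} ∘ ⋯ ∘ μ_{θ_1}(T)`. Sequences (finite or infinite) are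
encoded as `θ : ℕ → Option Arc` whose support is downward closed. -/
noncomputable def iterT (T : Set Arc) (θ : ℕ → Option Arc) : ℕ → Set Arc
  | 0 => T
  | k + 1 => stepT (iterT T θ k) (θ k)

/-- `iterA T θ γ k` is `μ_{θ_k} ∘ ⋯ ∘ μ_{θ_1}(γ)`. -/
noncomputable def iterA (T : Set Arc) (θ : ℕ → Option Arc) (γ : Arc) : ℕ → Arc
  | 0 => γ
  | k + 1 => stepA (iterT T θ k) (θ k) (iterA T θ γ k)

/-- `θ` is a `T`-admissible sequence: its support is downward closed (so it is a genuine
finite or infinite sequence), each entry is mutable in the triangulation obtained by the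
previous mutations, and the mutation of each arc of `T` along `θ` eventually stabilizes. -/
def Admissible (T : Set Arc) (θ : ℕ → Option Arc) : Prop :=
  (∀ i, θ i = none → θ (i + 1) = none) ∧
  (∀ i γ, θ i = some γ → IsMutable (iterT T θ i) γ) ∧
  (∀ γ ∈ T, ∃ l, ∀ k, l ≤ k → iterA T θ γ k = iterA T θ γ l)

/-- `μ_θ(γ)`: the stable value of the mutation of the arc `γ` along the sequence `θ`. -/
noncomputable def seqLimit (T : Set Arc) (θ : ℕ → Option Arc) (γ : Arc) : Arc :=
  if h : ∃ l, ∀ k, l ≤ k → iterA T θ γ k = iterA T θ γ l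
  then iterA T θ γ h.choose else γ

/-- `μ_θ(T)`: the mutation of `T` along the sequence `θ`. -/
noncomputable def mutSeq (T : Set Arc) (θ : ℕ → Option Arc) : Set Arc :=
  seqLimit T θ '' T

/-- The sequence `θ` leaves the arc `γ` untouched. -/
def Untouched (T : Set Arc) (θ : ℕ → Option Arc) (γ : Arc) : Prop :=
  ∀ l, iterA T θ γ l = γ

/-- The quadrilateral `S(γ)` of a mutable arc `γ` in `T`: with `v₁ < v₂ < v₃ < v₄` the four
endpoints of the two diagonals `γ` and `flipArc T γ`, it consists of those of the pairs
`(v₁,v₂), (v₂,v₃), (v₃,v₄), (v₁,v₄)` that are arcs. -/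
noncomputable def quad (T : Set Arc) (γ : Arc) : Set Arc :=
  let γ' := flipArc T γ
  let vs : Vtx × Vtx × Vtx × Vtx :=
    if γ.src < γ'.src then (γ.src, γ'.src, γ.tgt, γ'.tgt) else (γ'.src, γ.src, γ'.tgt, γ.tgt)
  {δ : Arc | (δ.src = vs.1 ∧ δ.tgt = vs.2.1) ∨ (δ.src = vs.2.1 ∧ δ.tgt = vs.2.2.1) ∨
    (δ.src = vs.2.2.1 ∧ δ.tgt = vs.2.2.2) ∨ (δ.src = vs.1 ∧ δ.tgt = vs.2.2.2)}

/-- The set `𝒫` of Prüfer curves compatible with every arc of `S`. -/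
def pruferCompletion (S : Set Arc) : Set Arc :=
  {γ | (∃ k : ℤ, γ = prufer k) ∧ ∀ x ∈ S, ¬ Cross γ x}

/-- The set `𝒜̃` of adic curves compatible with every arc of `S ∪ 𝒫(S)`. -/
def adicCompletion' (S : Set Arc) : Set Arc :=
  {γ | (∃ k : ℤ, γ = adic k) ∧ ∀ x ∈ S ∪ pruferCompletion S, ¬ Cross γ x}

/-- The completed (Prüfer) mutation `μ̄_θ(T) = μ_θ(T) ∪ 𝒫 ∪ 𝒜̃` of `T` along `θ`. -/
noncomputable def completedMut (T : Set Arc) (θ : ℕ → Option Arc) : Set Arc :=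
  mutSeq T θ ∪ pruferCompletion (mutSeq T θ) ∪ adicCompletion' (mutSeq T θ)

/-- The tower of triangulations associated to a composition of completed mutations. -/
noncomputable def compIter (T : Set Arc) (Θ : ℕ → Option (ℕ → Option Arc)) : ℕ → Set Arc
  | 0 => T
  | k + 1 =>
    match Θ k with
    | none => compIter T Θ k
    | some θ => completedMut (compIter T Θ k) θ

/-- `Θ` is a `T`-admissible composition of completed mutations. -/
def CompAdmissible (T : Set Arc) (Θ : ℕ → Option (ℕ → Option Arc)) : Prop :=
  (∀ i, Θ i = none → Θ (i + 1) = none) ∧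
  ∀ i θ, Θ i = some θ → Admissible (compIter T Θ i) θ

/-- The transfinite mutation of `T` along the composition `Θ`. -/
noncomputable def transfiniteMut (T : Set Arc) (Θ : ℕ → Option (ℕ → Option Arc)) : Set Arc :=
  ⋃ i, {γ ∈ compIter T Θ i |
    ∀ k, i ≤ k → ∀ θ, Θ k = some θ → Untouched (compIter T Θ k) θ γ}

/-- Linear crossing of pairs. -/
def CL {V : Type*} [LinearOrder V] (p q r s : V) : Prop :=
  (p < r ∧ r < q ∧ q < s) ∨ (r < p ∧ p < s ∧ s < q)

/-- Crossing of unordered pairs. -/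
def CU {V : Type*} [LinearOrder V] (p q r s : V) : Prop :=
  CL p q r s ∨ CL q p r s ∨ CL p q s r ∨ CL q p s r

lemma CU_of_lt {V : Type*} [LinearOrder V] {p q r s : V} (h : p < q) (h' : r < s) :
    CU p q r s ↔ CL p q r s := by
  unfold CU CL; grind

lemma quad_fact {V : Type*} [LinearOrder V] {a c b d p q : V} (hac : a < c) (hbd : b < d)
    (hpq : p < q) (hc : CL a c b d) (h1 : ¬ CU a b p q) (h2 : ¬ CU a d p q) (h3 : ¬ CU c b p q)
    (h4 : ¬ CU c d p q) (hx : CL b d p q) : p = a ∧ q = c := by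
  unfold CU CL at *; grind

lemma first_two {V W : Type*} [LinearOrder W] (k : V → W) (hk : Function.Injective k)
    (R : V → V → Prop) (hlt : ∀ p q, R p q → k p < k q)
    (hnc : ∀ p q r s, R p q → R r s → ¬ (k p < k r ∧ k r < k q ∧ k q < k s))
    (hmax : ∀ p q, k p < k q → ¬ R p q → ∃ r s, R r s ∧ CL (k p) (k q) (k r) (k s))
    (a b : V) (ha : ∀ v, k a ≤ k v)
    (X : Set (V × V)) (hX : ∀ u v, (u, v) ∈ X ↔ R u v ∧ k a < k u ∧ k u < k b ∧ k b < k v)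
    (hne : X.Nonempty)
    (hfin : ∀ u v, (u, v) ∈ X → {e ∈ X | k e.1 ≤ k u ∧ k v ≤ k e.2}.Finite) :
    ∃ u v w, (u, v) ∈ X ∧ (∀ u' v', (u', v') ∈ X → k u ≤ k u' ∧ k v' ≤ k v) ∧
      R a u ∧ R a v ∧ R u w ∧ R w v := by
  -- outermost element of a nonempty subset
  have key : ∀ Y ⊆ X, Y.Nonempty → ∃ u v, (u, v) ∈ Y ∧
      ∀ u' v', (u', v') ∈ Y → k u ≤ k u' ∧ k v' ≤ k v := by
    intro Y hY ⟨⟨u0, v0⟩, h0⟩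
    have hf : {e ∈ Y | k e.1 ≤ k u0 ∧ k v0 ≤ k e.2}.Finite :=
      (hfin u0 v0 (hY h0)).subset (fun e he => ⟨hY he.1, he.2⟩)
    obtain ⟨⟨u1, v1⟩, h1, hmin⟩ := Set.exists_min_image _ (fun e => k e.1) hf ⟨(u0, v0), h0, le_rfl, le_rfl⟩
    have hf2 : {e ∈ Y | (k e.1 ≤ k u0 ∧ k v0 ≤ k e.2) ∧ k e.1 = k u1}.Finite :=
      hf.subset (fun e he => ⟨he.1, he.2.1⟩)
    obtain ⟨⟨u2, v2⟩, h2, hmax2⟩ := Set.exists_max_image _ (fun e => k e.2) hf2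
      ⟨(u1, v1), h1.1, h1.2, rfl⟩
    refine ⟨u2, v2, h2.1, ?_⟩
    intro u' v' h'
    have hm := hmin (u', v')
    have hM := hmax2 (u', v')
    have x2 := (hX _ _).1 (hY h2.1)
    have x' := (hX _ _).1 (hY h')
    have x0 := (hX _ _).1 (hY h0)
    have n1 := hnc _ _ _ _ x2.1 x'.1
    have n2 := hnc _ _ _ _ x'.1 x2.1
    have n3 := hnc _ _ _ _ x0.1 x'.1
    have n4 := hnc _ _ _ _ x'.1 x0.1
    simp only [Set.mem_ofPred_eq] at *
    grind
  obtain ⟨u, v, hin, hout⟩ := key X subset_rfl hne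
  have h1 := (hX _ _).1 hin
  have hau : R a u := by
    by_contra hcon
    obtain ⟨r, s, hrs, hc⟩ := hmax _ _ h1.2.1 hcon
    have := hnc _ _ _ _ hrs h1.1
    have := hX r s
    have := hout r s
    have := ha r
    unfold CL at hc
    grind
  have hav : R a v := by
    by_contra hcon
    obtain ⟨r, s, hrs, hc⟩ := hmax a v (by grind) hcon
    have := hnc _ _ _ _ h1.1 hrs
    have := hX r s
    have := hout r s
    have := ha r
    unfold CL at hc
    grind
  by_cases hY : (X \ {(u, v)}).Nonempty
  · obtain ⟨u2, v2, hin2, hout2⟩ := key _ Set.sdiff_subset hY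
    have h2 := (hX _ _).1 hin2.1
    have hb := hout _ _ hin2.1
    have hout2' : ∀ r s, R r s → k r < k b → k b < k s → k a < k r → (k r ≠ k u ∨ k s ≠ k v) →
        k u2 ≤ k r ∧ k s ≤ k v2 := by
      intro r s h3 h4 h5 h6 h7
      apply hout2
      refine ⟨(hX _ _).2 ⟨h3, h6, h4, h5⟩, ?_⟩
      intro h
      simp at h
      grind
    have hne2 : k u2 ≠ k u ∨ k v2 ≠ k v := by
      by_contra hcon
      push Not at hcon
      exact hin2.2 (by simp [hk hcon.1, hk hcon.2])
    have hor : k u2 = k u ∨ k v2 = k v := by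
      by_contra hcon
      push Not at hcon
      have : R u v2 := by
        by_contra hcon2
        obtain ⟨r, s, hrs, hc⟩ := hmax u v2 (by grind) hcon2
        have := hnc _ _ _ _ h1.1 hrs
        have := hnc _ _ _ _ hrs h1.1
        have := hnc _ _ _ _ h2.1 hrs
        have := hnc _ _ _ _ hrs h2.1
        have := hout2' r s hrs
        have := ha r
        unfold CL at hc
        grind
      have := hout2' u v2 this
      grind
    rcases hor with h | h
    · have hu := hk h
      subst hu
      refine ⟨u2, v, v2, hin, hout, hau, hav, h2.1, ?_⟩
      by_contra hcon2
      obtain ⟨r, s, hrs, hc⟩ := hmax v2 v (by grind) hcon2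
      have := hnc _ _ _ _ h1.1 hrs
      have := hnc _ _ _ _ hrs h1.1
      have := hnc _ _ _ _ h2.1 hrs
      have := hnc _ _ _ _ hrs h2.1
      have := hout2' r s hrs
      have := ha r
      unfold CL at hc
      grind
    · have hu := hk h
      subst hu
      refine ⟨u, v2, u2, hin, hout, hau, hav, ?_, h2.1⟩
      by_contra hcon2
      obtain ⟨r, s, hrs, hc⟩ := hmax u u2 (by grind) hcon2
      have := hnc _ _ _ _ h1.1 hrs
      have := hnc _ _ _ _ hrs h1.1
      have := hnc _ _ _ _ h2.1 hrs
      have := hnc _ _ _ _ hrs h2.1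
      have := hout2' r s hrs
      have := ha r
      unfold CL at hc
      grind
  · have hY' : ∀ r s, R r s → k r < k b → k b < k s → k a < k r → k r = k u ∧ k s = k v := by
      intro r s h3 h4 h5 h6
      by_contra hcon
      apply hY
      refine ⟨(r, s), (hX _ _).2 ⟨h3, h6, h4, h5⟩, ?_⟩
      intro h
      simp at h
      grind
    refine ⟨u, v, b, hin, hout, hau, hav, ?_, ?_⟩
    · by_contra hcon2
      obtain ⟨r, s, hrs, hc⟩ := hmax u b (by grind) hcon2
      have := hnc _ _ _ _ h1.1 hrs
      have := hnc _ _ _ _ hrs h1.1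
      have := hY' r s hrs
      have := ha r
      unfold CL at hc
      grind
    · by_contra hcon2
      obtain ⟨r, s, hrs, hc⟩ := hmax b v (by grind) hcon2
      have := hnc _ _ _ _ h1.1 hrs
      have := hnc _ _ _ _ hrs h1.1
      have := hY' r s hrs
      have := ha r
      unfold CL at hc
      grind


lemma arc_ext' {x y : Arc} (h1 : x.src = y.src) (h2 : x.tgt = y.tgt) : x = y := by
  cases x; cases y; simp_all

lemma exists_arc {p c q : Vtx} (h1 : p < c) (h2 : c < q) : ∃ x : Arc, x.src = p ∧ x.tgt = q := by
  refine ⟨⟨p, q, h1.trans h2, ?_⟩, rfl, rfl⟩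
  rintro m n rfl rfl
  induction c using WithBot.recBotCoe with
  | bot => simp at h1
  | coe c =>
    induction c using WithTop.recTopCoe with
    | top => simp [vInt] at h2
    | coe c =>
      simp only [vInt, WithBot.coe_lt_coe, WithTop.coe_lt_coe] at h1 h2
      omega

lemma CU_symm {V : Type*} [LinearOrder V] {p q r s : V} : CU p q r s ↔ CU r s p q := by
  unfold CU CL; grind

lemma CU_swap {V : Type*} [LinearOrder V] {p q r s : V} : CU p q r s ↔ CU q p r s := by
  unfold CU CL; grind

lemma Cross_symm {x y : Arc} : Cross x y ↔ Cross y x := by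
  unfold Cross; grind

lemma Cross_iff_CU {x y : Arc} : Cross x y ↔ CU x.src x.tgt y.src y.tgt :=
  (CU_of_lt x.lt y.lt).symm

/-- The pair `{p,q}` is crossed by no arc of `T`. -/
def okU (T : Set Arc) (p q : Vtx) : Prop := ∀ x ∈ T, ¬ CU p q x.src x.tgt

lemma okU_swap {T : Set Arc} {p q : Vtx} (h : okU T p q) : okU T q p :=
  fun x hx hc => h x hx (CU_swap.1 hc)

lemma okU_of_mem {T : Set Arc} (hT : IsTriangulation T) {x : Arc} (hx : x ∈ T) :
    okU T x.src x.tgt := fun y hy h => hT.1 x hx y hy (Cross_iff_CU.2 h)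

lemma mem_of_okU {T : Set Arc} (hT : IsTriangulation T) {x : Arc} (hx : okU T x.src x.tgt) :
    x ∈ T := hT.2 x fun y hy h => hx y hy (Cross_iff_CU.1 h)

lemma exists_arc_of_CU {p q r s : Vtx} (h : CU p q r s) :
    ∃ x : Arc, (x.src = p ∧ x.tgt = q) ∨ (x.src = q ∧ x.tgt = p) := by
  have : (∃ c, p < c ∧ c < q) ∨ (∃ c, q < c ∧ c < p) := by
    unfold CU CL at h; grind
  rcases this with ⟨c, h1, h2⟩ | ⟨c, h1, h2⟩
  · obtain ⟨x, hx⟩ := exists_arc h1 h2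
    exact ⟨x, Or.inl hx⟩
  · obtain ⟨x, hx⟩ := exists_arc h1 h2
    exact ⟨x, Or.inr hx⟩

lemma exists_mem_of_okU_CU {T : Set Arc} (hT : IsTriangulation T) {p q r s : Vtx}
    (h : okU T p q) (hc : CU p q r s) :
    ∃ x ∈ T, (x.src = p ∧ x.tgt = q) ∨ (x.src = q ∧ x.tgt = p) := by
  obtain ⟨x, hx⟩ := exists_arc_of_CU hc
  refine ⟨x, ?_, hx⟩
  rcases hx with ⟨h1, h2⟩ | ⟨h1, h2⟩
  · exact mem_of_okU hT (by rw [h1, h2]; exact h)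
  · exact mem_of_okU hT (by rw [h1, h2]; exact okU_swap h)

lemma okU_noncross {T : Set Arc} (hT : IsTriangulation T) {p q r s : Vtx}
    (h : okU T p q) (h' : okU T r s) : ¬ CU p q r s := by
  intro hc
  obtain ⟨x, hx, hx'⟩ := exists_mem_of_okU_CU hT h hc
  rcases hx' with ⟨rfl, rfl⟩ | ⟨rfl, rfl⟩
  · exact h' x hx (CU_symm.1 hc)
  · exact h' x hx (CU_symm.1 (CU_swap.1 hc))

lemma exchange_cross {T : Set Arc} (hT : IsTriangulation T) {γ γ' : Arc} (hγ : γ ∈ T)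
    (h : MutExchange T γ γ') : Cross γ γ' := by
  by_contra hc
  have : γ ∈ (T \ {γ}) ∪ {γ'} := by
    apply h.2.2
    rintro x (hx | hx)
    · exact hT.1 _ hγ _ hx.1
    · rw [hx]; exact hc
  rcases this with h1 | h1
  · exact h1.2 rfl
  · exact h.1 h1.symm

lemma flip_spec {T : Set Arc} {γ : Arc} (h : IsMutable T γ) : MutExchange T γ (flipArc T γ) := by
  unfold flipArc
  rw [dif_pos h.2]
  exact h.2.choose_spec

lemma quad_unique {T : Set Arc} (hT : IsTriangulation T) {γ γ' : Arc}
    (hc : Cross γ γ') (h1 : okU T γ.src γ'.src) (h2 : okU T γ.src γ'.tgt)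
    (h3 : okU T γ.tgt γ'.src) (h4 : okU T γ.tgt γ'.tgt) {δ : Arc}
    (hδ : ∀ x ∈ T, x ≠ γ → ¬ Cross δ x) (hδγ : Cross γ δ) : δ = γ' := by
  have key : ∀ p q, okU T p q → q ≠ γ.src → q ≠ γ.tgt → ¬ CU p q δ.src δ.tgt := by
    intro p q hpq hne hne' hcu
    obtain ⟨x, hx, hx'⟩ := exists_mem_of_okU_CU hT hpq hcu
    by_cases hxγ : x = γ
    · subst hxγ
      rcases hx' with ⟨-, h⟩ | ⟨h, -⟩
      · exact hne' h.symm
      · exact hne h.symm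
    · apply hδ x hx hxγ
      rw [Cross_iff_CU]
      rcases hx' with ⟨rfl, rfl⟩ | ⟨rfl, rfl⟩
      · exact (CU_symm.1 hcu)
      · exact (CU_symm.1 (CU_swap.1 hcu))
  have hc' : CL γ'.src γ'.tgt γ.src γ.tgt := Cross_symm.1 hc
  have hlt := γ.lt
  have hlt' := γ'.lt
  have e1 : γ'.src ≠ γ.src := by unfold CL at hc'; grind
  have e2 : γ'.src ≠ γ.tgt := by unfold CL at hc'; grind
  have e3 : γ'.tgt ≠ γ.src := by unfold CL at hc'; grind
  have e4 : γ'.tgt ≠ γ.tgt := by unfold CL at hc'; grind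
  have := quad_fact γ'.lt γ.lt δ.lt hc' (fun h => key _ _ h1 e1 e2 (CU_swap.1 h))
    (fun h => key _ _ h3 e1 e2 (CU_swap.1 h)) (fun h => key _ _ h2 e3 e4 (CU_swap.1 h))
    (fun h => key _ _ h4 e3 e4 (CU_swap.1 h)) hδγ
  exact arc_ext' this.1 this.2

lemma quad_flip {T : Set Arc} (hT : IsTriangulation T) {γ γ' : Arc} (hγ : γ ∈ T)
    (hc : Cross γ γ') (h1 : okU T γ.src γ'.src) (h2 : okU T γ.src γ'.tgt)
    (h3 : okU T γ.tgt γ'.src) (h4 : okU T γ.tgt γ'.tgt) :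
    IsMutable T γ ∧ flipArc T γ = γ' := by
  have hne : γ' ≠ γ := by
    rintro rfl
    unfold Cross at hc; grind
  have hex : MutExchange T γ γ' := by
    refine ⟨hne, ?_, ?_⟩
    · have hx : ∀ x ∈ T, x ≠ γ → ¬ Cross γ' x := by
        intro x hx hxγ hcx
        apply hxγ
        have := quad_fact γ.lt γ'.lt x.lt hc (h1 x hx) (h2 x hx) (h3 x hx) (h4 x hx) hcx
        exact arc_ext' this.1 this.2
      rintro x (⟨hx1, hx2⟩ | rfl) y (⟨hy1, hy2⟩ | rfl)
      · exact hT.1 x hx1 y hy1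
      · exact fun h => hx x hx1 hx2 (Cross_symm.1 h)
      · exact hx y hy1 hy2
      · unfold Cross; grind
    · intro δ hδ
      by_cases hδγ : Cross γ δ
      · right
        exact quad_unique hT hc h1 h2 h3 h4 (fun x hx hxγ => hδ x (Or.inl ⟨hx, hxγ⟩)) hδγ
      · left
        refine ⟨hT.2 δ fun x hx => ?_, ?_⟩
        · by_cases hxγ : x = γ
          · subst hxγ; exact fun h => hδγ (Cross_symm.1 h)
          · exact hδ x (Or.inl ⟨hx, hxγ⟩)
        · rintro rfl
          exact hδ γ' (Or.inr rfl) hc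
  have hm : IsMutable T γ := ⟨hγ, γ', hex⟩
  refine ⟨hm, ?_⟩
  have hs := flip_spec hm
  refine quad_unique hT hc h1 h2 h3 h4 ?_ (exchange_cross hT hγ hs)
  intro x hx hxγ
  exact hs.2.1 _ (Or.inr rfl) x (Or.inl ⟨hx, hxγ⟩)

/-- Sorting key for the cyclic order cut open at `a`. -/
noncomputable def ky (a x : Vtx) : Bool ×ₗ Vtx := toLex (decide (x < a), x)

lemma ky_lt_iff {a x y : Vtx} :
    ky a x < ky a y ↔ (¬ x < a ∧ y < a) ∨ ((x < a ↔ y < a) ∧ x < y) := by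
  unfold ky
  rw [Prod.Lex.toLex_lt_toLex]
  by_cases h1 : x < a <;> by_cases h2 : y < a <;> simp [h1, h2]

lemma ky_inj (a : Vtx) : Function.Injective (ky a) := by
  intro x y h
  simpa [ky] using (congrArg (fun z => (ofLex z).2) h)

lemma ky_min (a v : Vtx) : ky a a ≤ ky a v := by
  rw [← not_lt, ky_lt_iff]; grind

lemma CU_ky {a p q r s : Vtx} (h : ky a p < ky a q) (h' : ky a r < ky a s) :
    CU p q r s ↔ CL (ky a p) (ky a q) (ky a r) (ky a s) := by
  unfold CU CL
  simp only [ky_lt_iff] at *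
  grind


lemma CU_swap' {V : Type*} [LinearOrder V] {p q r s : V} : CU p q r s ↔ CU p q s r := by
  unfold CU CL; grind

lemma not_CU_share {V : Type*} [LinearOrder V] {a w b : V} : ¬ CU a w a b := by
  unfold CU CL; grind

/-- `e'` comes before `e` when looking from `a`. -/
def Bf (a : Vtx) (e' e : Arc) : Prop :=
  min (ky a e'.src) (ky a e'.tgt) ≤ min (ky a e.src) (ky a e.tgt) ∧
  max (ky a e.src) (ky a e.tgt) ≤ max (ky a e'.src) (ky a e'.tgt)

/-- Endpoints of an arc, sorted by the cyclic order cut open at `a`. -/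
noncomputable def sortP (a : Vtx) (x : Arc) : Vtx × Vtx :=
  if ky a x.src < ky a x.tgt then (x.src, x.tgt) else (x.tgt, x.src)

lemma sortP_spec (a : Vtx) (x : Arc) :
    ky a (sortP a x).1 < ky a (sortP a x).2 ∧
    (((sortP a x).1 = x.src ∧ (sortP a x).2 = x.tgt) ∨
      ((sortP a x).1 = x.tgt ∧ (sortP a x).2 = x.src)) ∧
    ky a (sortP a x).1 = min (ky a x.src) (ky a x.tgt) ∧
    ky a (sortP a x).2 = max (ky a x.src) (ky a x.tgt) := by
  have hne : ky a x.src ≠ ky a x.tgt := fun h => x.lt.ne (ky_inj a h)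
  unfold sortP
  split_ifs with h
  · exact ⟨h, Or.inl ⟨rfl, rfl⟩, (min_eq_left h.le).symm, (max_eq_right h.le).symm⟩
  · have h' : ky a x.tgt < ky a x.src := lt_of_le_of_ne (not_lt.1 h) hne.symm
    exact ⟨h', Or.inr ⟨rfl, rfl⟩, (min_eq_right h'.le).symm, (max_eq_left h'.le).symm⟩

lemma first_flip {T : Set Arc} (hT : IsTriangulation T) (s : Arc) (a b : Vtx)
    (hab : (s.src = a ∧ s.tgt = b) ∨ (s.src = b ∧ s.tgt = a))
    (hne : ∃ x ∈ T, Cross x s)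
    (hfin : ∀ e ∈ T, Cross e s → {e' | e' ∈ T ∧ Cross e' s ∧ Bf a e' e}.Finite) :
    ∃ e ∈ T, Cross e s ∧ IsMutable T e ∧ ¬ Cross (flipArc T e) s ∧
      (∀ e' ∈ T, Cross e' s → Bf a e e') ∧ okU T a e.src ∧ okU T a e.tgt := by
  have hkab : ky a a < ky a b := by
    refine lt_of_le_of_ne (ky_min a b) fun h => ?_
    have := ky_inj a h
    have := s.lt
    grind
  have hcs : ∀ x : Arc, Cross x s ↔ CU x.src x.tgt a b := by
    intro x
    rw [Cross_iff_CU]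
    rcases hab with ⟨h1, h2⟩ | ⟨h1, h2⟩
    · rw [h1, h2]
    · rw [h1, h2]; unfold CU; tauto
  have hcross : ∀ x : Arc, Cross x s ↔ ky a a < ky a (sortP a x).1 ∧
      ky a (sortP a x).1 < ky a b ∧ ky a b < ky a (sortP a x).2 := by
    intro x
    obtain ⟨h1, h2, -, -⟩ := sortP_spec a x
    have h3 : Cross x s ↔ CU (sortP a x).1 (sortP a x).2 a b := by
      rw [hcs]
      rcases h2 with ⟨h4, h5⟩ | ⟨h4, h5⟩
      · rw [h4, h5]
      · rw [h4, h5, CU_swap]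
    rw [h3, CU_ky h1 hkab]
    have := ky_min a (sortP a x).1
    unfold CL
    grind
  let R : Vtx → Vtx → Prop := fun p q => ky a p < ky a q ∧ okU T p q
  have hRs : ∀ x ∈ T, R (sortP a x).1 (sortP a x).2 := by
    intro x hx
    obtain ⟨h1, h2, -, -⟩ := sortP_spec a x
    refine ⟨h1, ?_⟩
    rcases h2 with ⟨h4, h5⟩ | ⟨h4, h5⟩
    · rw [h4, h5]; exact okU_of_mem hT hx
    · rw [h4, h5]; exact okU_swap (okU_of_mem hT hx)
  have hnc : ∀ p q r s, R p q → R r s →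
      ¬ (ky a p < ky a r ∧ ky a r < ky a q ∧ ky a q < ky a s) := by
    intro p q r s h h' hc
    exact okU_noncross hT h.2 h'.2 ((CU_ky h.1 h'.1).2 (Or.inl hc))
  have hmax : ∀ p q, ky a p < ky a q → ¬ R p q →
      ∃ r s, R r s ∧ CL (ky a p) (ky a q) (ky a r) (ky a s) := by
    intro p q hpq hR
    have : ¬ okU T p q := fun h => hR ⟨hpq, h⟩
    unfold okU at this
    push Not at this
    obtain ⟨x, hx, hc⟩ := this
    obtain ⟨h1, h2, -, -⟩ := sortP_spec a x
    refine ⟨_, _, hRs x hx, ?_⟩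
    rw [← CU_ky hpq h1]
    rcases h2 with ⟨h4, h5⟩ | ⟨h4, h5⟩
    · rw [h4, h5]; exact hc
    · rw [h4, h5]; exact CU_symm.1 (CU_swap.1 (CU_symm.1 hc))
  have hX : ∀ u v, (u, v) ∈ sortP a '' {x | x ∈ T ∧ Cross x s} ↔
      R u v ∧ ky a a < ky a u ∧ ky a u < ky a b ∧ ky a b < ky a v := by
    intro u v
    constructor
    · rintro ⟨x, ⟨hx, hxs⟩, hxe⟩
      have h1 := hRs x hx
      have h2 := (hcross x).1 hxs
      rw [hxe] at h1 h2
      exact ⟨h1, h2⟩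
    · rintro ⟨hR, h1, h2, h3⟩
      have hcu : CU u v a b := (CU_ky hR.1 hkab).2 (Or.inr ⟨h1, h2, h3⟩)
      obtain ⟨x, hx, hx'⟩ := exists_mem_of_okU_CU hT hR.2 hcu
      have hsx : sortP a x = (u, v) := by
        have hlt := hR.1
        unfold sortP
        rcases hx' with ⟨h4, h5⟩ | ⟨h4, h5⟩
        · rw [h4, h5, if_pos hlt]
        · rw [h4, h5, if_neg (not_lt.2 hlt.le)]
      refine ⟨x, ⟨hx, ?_⟩, hsx⟩
      rw [hcross, hsx]
      exact ⟨h1, h2, h3⟩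
  obtain ⟨u, v, w, huv, hout, hau, hav, huw, hwv⟩ := first_two (ky a) (ky_inj a) R
    (fun p q h => h.1) hnc hmax a b (ky_min a) (sortP a '' {x | x ∈ T ∧ Cross x s}) hX
    (by obtain ⟨x, hx, hxs⟩ := hne; exact ⟨_, x, ⟨hx, hxs⟩, rfl⟩)
    (by
      rintro u v ⟨x, ⟨hx, hxs⟩, hxe⟩
      refine ((hfin x hx hxs).image (sortP a)).subset ?_
      rintro _ ⟨⟨y, ⟨hy, hys⟩, rfl⟩, hy1, hy2⟩
      refine ⟨y, ⟨hy, hys, ?_⟩, rfl⟩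
      obtain ⟨-, -, h3, h4⟩ := sortP_spec a x
      obtain ⟨-, -, h5, h6⟩ := sortP_spec a y
      rw [hxe] at h3 h4
      unfold Bf
      rw [← h3, ← h4, ← h5, ← h6]
      exact ⟨hy1, hy2⟩)
  have hall := (hX _ _).1 huv
  obtain ⟨e, ⟨he, hes⟩, hse⟩ := huv
  obtain ⟨-, h2, h3, h4⟩ := sortP_spec a e
  rw [hse] at h2 h3 h4
  simp only at h2 h3 h4
  have hk1 := huw.1
  have hk2 := hwv.1
  have hk3 := hau.1
  have hcu : CU u v a w := (CU_ky hall.1.1 (hk3.trans hk1)).2 (Or.inr ⟨hk3, hk1, hk2⟩)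
  obtain ⟨e', he'⟩ := exists_arc_of_CU (CU_symm.1 hcu)
  have hquad : IsMutable T e ∧ flipArc T e = e' := by
    have hcr : Cross e e' := by
      rw [Cross_iff_CU]
      rcases h2 with ⟨h5, h6⟩ | ⟨h5, h6⟩ <;> rcases he' with ⟨h7, h8⟩ | ⟨h7, h8⟩ <;>
        rw [h7, h8, ← h5, ← h6]
      · exact hcu
      · exact CU_swap'.1 hcu
      · exact CU_swap.1 hcu
      · exact CU_swap'.1 (CU_swap.1 hcu)
    have o1 := okU_swap hau.2
    have o2 := okU_swap hav.2
    have o3 := huw.2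
    have o4 := okU_swap hwv.2
    rcases h2 with ⟨h5, h6⟩ | ⟨h5, h6⟩ <;> rcases he' with ⟨h7, h8⟩ | ⟨h7, h8⟩ <;>
      apply quad_flip hT he hcr <;> simp only [h7, h8, ← h5, ← h6] <;> assumption
  refine ⟨e, he, hes, hquad.1, ?_, ?_, ?_, ?_⟩
  · rw [hquad.2, hcs]
    rcases he' with ⟨h7, h8⟩ | ⟨h7, h8⟩ <;> rw [h7, h8]
    · exact not_CU_share
    · exact fun h => not_CU_share (CU_swap.1 h)
  · intro e'' h1 h5
    have := hout _ _ ⟨e'', ⟨h1, h5⟩, rfl⟩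
    obtain ⟨-, -, h6, h7⟩ := sortP_spec a e''
    unfold Bf
    rw [← h3, ← h4, ← h6, ← h7]
    exact this
  · rcases h2 with ⟨h5, h6⟩ | ⟨h5, h6⟩
    · rw [← h5]; exact hau.2
    · rw [← h6]; exact hav.2
  · rcases h2 with ⟨h5, h6⟩ | ⟨h5, h6⟩
    · rw [← h6]; exact hav.2
    · rw [← h5]; exact hau.2


lemma step_tri {T : Set Arc} {γ : Arc} (h : IsMutable T γ) : IsTriangulation (mutate T γ) :=
  (flip_spec h).2

lemma iterT_tri {T : Set Arc} (hT : IsTriangulation T) {θ : ℕ → Option Arc}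
    (hθ : Admissible T θ) (k : ℕ) : IsTriangulation (iterT T θ k) := by
  induction k with
  | zero => exact hT
  | succ k ih =>
    have h := hθ.2.1 k
    simp only [iterT]
    cases hk : θ k with
    | none => simpa [stepT] using ih
    | some γ => exact step_tri (h γ hk)

lemma iterA_mem {T : Set Arc} {θ : ℕ → Option Arc} {γ : Arc} (hγ : γ ∈ T) (k : ℕ) :
    iterA T θ γ k ∈ iterT T θ k := by
  induction k with
  | zero => exact hγ
  | succ k ih =>
    simp only [iterT, iterA]
    cases hk : θ k with
    | none => simpa [stepT, stepA] using ih
    | some δ =>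
      simp only [stepT, stepA, mutArc, mutate]
      split_ifs with h
      · right; rfl
      · left; exact ⟨ih, h⟩

lemma iterA_surj {T : Set Arc} {θ : ℕ → Option Arc}
    (hθ : Admissible T θ) (k : ℕ) {x : Arc} (hx : x ∈ iterT T θ k) :
    ∃ γ ∈ T, iterA T θ γ k = x := by
  induction k generalizing x with
  | zero => exact ⟨x, hx, rfl⟩
  | succ k ih =>
    have hm := hθ.2.1 k
    simp only [iterT, iterA] at *
    cases hk : θ k with
    | none =>
      rw [hk] at hx
      simpa [stepA] using ih hx
    | some δ =>
      rw [hk] at hx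
      simp only [stepT, stepA, mutArc, mutate] at *
      rcases hx with ⟨h1, h2⟩ | h
      · obtain ⟨γ, hγ, rfl⟩ := ih h1
        exact ⟨γ, hγ, if_neg h2⟩
      · obtain ⟨γ, hγ, he⟩ := ih (hm δ hk).1
        exact ⟨γ, hγ, by rw [if_pos he]; exact h.symm⟩

lemma seqLimit_eq {T : Set Arc} {θ : ℕ → Option Arc} {γ x : Arc} {l : ℕ}
    (h : ∀ k, l ≤ k → iterA T θ γ k = x) : seqLimit T θ γ = x := by
  have hex : ∃ l, ∀ k, l ≤ k → iterA T θ γ k = iterA T θ γ l :=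
    ⟨l, fun k hk => by rw [h k hk, h l le_rfl]⟩
  unfold seqLimit
  rw [dif_pos hex]
  have := hex.choose_spec (max l hex.choose) (le_max_right _ _)
  rw [← this, h _ (le_max_left _ _)]

lemma mem_mutSeq_iff {T : Set Arc} {θ : ℕ → Option Arc} (hθ : Admissible T θ) {x : Arc} :
    x ∈ mutSeq T θ ↔ ∃ γ ∈ T, ∃ l, ∀ k, l ≤ k → iterA T θ γ k = x := by
  constructor
  · rintro ⟨γ, hγ, rfl⟩
    obtain ⟨l, hl⟩ := hθ.2.2 γ hγ
    refine ⟨γ, hγ, l, fun k hk => ?_⟩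
    rw [seqLimit_eq hl, hl k hk]
  · rintro ⟨γ, hγ, l, hl⟩
    exact ⟨γ, hγ, seqLimit_eq hl⟩

lemma mutSeq_eventually {T : Set Arc} {θ : ℕ → Option Arc} (hθ : Admissible T θ) {x : Arc}
    (hx : x ∈ mutSeq T θ) : ∃ l, ∀ k, l ≤ k → x ∈ iterT T θ k := by
  obtain ⟨γ, hγ, l, hl⟩ := (mem_mutSeq_iff hθ).1 hx
  exact ⟨l, fun k hk => by rw [← hl k hk]; exact iterA_mem hγ k⟩

lemma mutSeq_noncross {T : Set Arc} (hT : IsTriangulation T) {θ : ℕ → Option Arc}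
    (hθ : Admissible T θ) {x y : Arc} (hx : x ∈ mutSeq T θ) (hy : y ∈ mutSeq T θ) :
    ¬ Cross x y := by
  obtain ⟨l, hl⟩ := mutSeq_eventually hθ hx
  obtain ⟨l', hl'⟩ := mutSeq_eventually hθ hy
  exact (iterT_tri hT hθ (max l l')).1 x (hl _ (le_max_left _ _)) y (hl' _ (le_max_right _ _))

lemma prufer_noncross (m n : ℤ) : ¬ Cross (prufer m) (prufer n) := by
  unfold Cross prufer; grind

lemma adic_noncross (m n : ℤ) : ¬ Cross (adic m) (adic n) := by
  unfold Cross adic; grind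

lemma completed_noncross {T : Set Arc} (hT : IsTriangulation T) {θ : ℕ → Option Arc}
    (hθ : Admissible T θ) {x y : Arc} (hx : x ∈ completedMut T θ) (hy : y ∈ completedMut T θ) :
    ¬ Cross x y := by
  have key : ∀ x ∈ mutSeq T θ ∪ pruferCompletion (mutSeq T θ),
      ∀ y ∈ mutSeq T θ ∪ pruferCompletion (mutSeq T θ), ¬ Cross x y := by
    rintro x (hx | hx) y (hy | hy)
    · exact mutSeq_noncross hT hθ hx hy
    · exact fun h => hy.2 x hx (Cross_symm.1 h)
    · exact hx.2 y hy
    · obtain ⟨⟨m, rfl⟩, -⟩ := hx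
      obtain ⟨⟨n, rfl⟩, -⟩ := hy
      exact prufer_noncross m n
  rcases hx with hx | hx <;> rcases hy with hy | hy
  · exact key x hx y hy
  · exact fun h => hy.2 x hx (Cross_symm.1 h)
  · exact hx.2 y hy
  · obtain ⟨⟨m, rfl⟩, -⟩ := hx
    obtain ⟨⟨n, rfl⟩, -⟩ := hy
    exact adic_noncross m n

lemma vInt_lt {m n : ℤ} : vInt m < vInt n ↔ m < n := by
  simp [vInt, WithBot.coe_lt_coe, WithTop.coe_lt_coe]

lemma vInt_le {m n : ℤ} : vInt m ≤ vInt n ↔ m ≤ n := by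
  simp [vInt, WithBot.coe_le_coe, WithTop.coe_le_coe]

lemma vInt_inj {m n : ℤ} : vInt m = vInt n ↔ m = n := by
  simp [vInt]

lemma vtx_cases (v : Vtx) : v = vBot ∨ v = vTop ∨ ∃ m, v = vInt m := by
  induction v using WithBot.recBotCoe with
  | bot => exact Or.inl rfl
  | coe c =>
    induction c using WithTop.recTopCoe with
    | top => exact Or.inr (Or.inl rfl)
    | coe c => exact Or.inr (Or.inr ⟨c, rfl⟩)

lemma vBot_le (v : Vtx) : vBot ≤ v := bot_le

lemma le_vTop (v : Vtx) : v ≤ vTop := by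
  rcases vtx_cases v with rfl | rfl | ⟨m, rfl⟩
  · exact vBot_lt_vTop.le
  · exact le_rfl
  · exact (vInt_lt_vTop m).le

lemma lt_vInt_succ {v : Vtx} {m : ℤ} (h : v < vInt (m + 1)) : v ≤ vInt m := by
  rcases vtx_cases v with rfl | rfl | ⟨n, rfl⟩
  · exact vBot_le _
  · exact absurd h (not_lt.2 (le_vTop _))
  · rw [vInt_lt] at h; rw [vInt_le]; omega

lemma vInt_lt_succ {v : Vtx} {m : ℤ} (h : vInt m < v) : vInt (m + 1) ≤ v := by
  by_contra hc
  exact absurd h (not_lt.2 (lt_vInt_succ (not_le.1 hc)))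

lemma cover_arc (A : Set Arc) (hA : ∀ x ∈ A, ∀ y ∈ A, ¬ Cross x y) (a b : ℤ) (hab : a + 2 ≤ b)
    (hc : ∀ c, a < c → c < b → ∃ x ∈ A, x.src < vInt c ∧ vInt c < x.tgt) :
    ∃ x ∈ A, x.src ≤ vInt a ∧ vInt b ≤ x.tgt := by
  have key : ∀ n : ℕ, a + 1 + n < b → ∃ x ∈ A, x.src ≤ vInt a ∧ vInt (a + 1 + n) < x.tgt := by
    intro n
    induction n with
    | zero =>
      intro h
      obtain ⟨x, hx, h1, h2⟩ := hc (a + 1) (by omega) (by omega)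
      exact ⟨x, hx, lt_vInt_succ h1, by simpa using h2⟩
    | succ n ih =>
      intro h
      obtain ⟨x, hx, h1, h2⟩ := ih (by push_cast at h; omega)
      obtain ⟨y, hy, h3, h4⟩ := hc (a + 1 + n + 1) (by omega) (by push_cast at h; omega)
      have hle := vInt_lt_succ h2
      have e : a + 1 + ((n + 1 : ℕ) : ℤ) = a + 1 + n + 1 := by push_cast; ring
      rw [e]
      by_cases h5 : vInt (a + 1 + n + 1) < x.tgt
      · exact ⟨x, hx, h1, h5⟩
      · refine ⟨y, hy, ?_, h4⟩
        have := hA x hx y hy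
        unfold Cross at this
        grind
  obtain ⟨x, hx, h1, h2⟩ := key (b - a - 2).toNat (by omega)
  refine ⟨x, hx, h1, ?_⟩
  have := vInt_lt_succ h2
  convert this using 2
  omega

lemma finite_inside (m n : ℤ) : {x : Arc | vInt m ≤ x.src ∧ x.tgt ≤ vInt n}.Finite := by
  have : {v : Vtx | vInt m ≤ v ∧ v ≤ vInt n}.Finite := by
    refine ((Set.finite_Icc m n).image vInt).subset ?_
    rintro v ⟨h1, h2⟩
    rcases vtx_cases v with rfl | rfl | ⟨k, rfl⟩
    · exact absurd (vBot_lt_vInt m) (not_lt.2 h1)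
    · exact absurd (vInt_lt_vTop n) (not_lt.2 h2)
    · exact ⟨k, ⟨vInt_le.1 h1, vInt_le.1 h2⟩, rfl⟩
  refine Set.Finite.of_finite_image (f := fun x : Arc => (x.src, x.tgt))
    ((this.prod this).subset ?_) ?_
  · rintro _ ⟨x, ⟨h1, h2⟩, rfl⟩
    exact ⟨⟨h1, x.lt.le.trans h2⟩, ⟨h1.trans x.lt.le, h2⟩⟩
  · intro x _ y _ h
    exact arc_ext' (Prod.ext_iff.1 h).1 (Prod.ext_iff.1 h).2

lemma inside_of_cross {e γ z : Arc} (h1 : e.src ≤ γ.src) (h2 : γ.tgt ≤ e.tgt) (h : ¬ Cross z e)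
    (hc : Cross z γ) : e.src ≤ z.src ∧ z.tgt ≤ e.tgt := by
  unfold Cross at *; grind

lemma mem_mutSeq_of_inside {T : Set Arc} (hT : IsTriangulation T) {θ : ℕ → Option Arc}
    (hθ : Admissible T θ) {e γ : Arc} (he : e ∈ mutSeq T θ) {m n : ℤ} (hm : e.src = vInt m)
    (hn : e.tgt = vInt n) (h1 : e.src ≤ γ.src) (h2 : γ.tgt ≤ e.tgt)
    (hγ : ∀ x ∈ mutSeq T θ, ¬ Cross γ x) : γ ∈ mutSeq T θ := by
  obtain ⟨K, hK⟩ := mutSeq_eventually hθ he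
  have htri := iterT_tri hT hθ
  let A := {x | x ∈ iterT T θ K ∧ e.src ≤ x.src ∧ x.tgt ≤ e.tgt}
  have hA : A.Finite := (finite_inside m n).subset (fun x hx => by
    have := hx.2; rw [hm, hn] at this; exact this)
  have htr : ∀ x, ∃ δ, x ∈ A → δ ∈ T ∧ iterA T θ δ K = x := by
    intro x
    by_cases hx : x ∈ A
    · obtain ⟨δ, hδ⟩ := iterA_surj hθ K hx.1
      exact ⟨δ, fun _ => hδ⟩
    · exact ⟨x, fun h => absurd h hx⟩
  choose d hd using htr
  have hst : ∀ x, ∃ l, x ∈ A → ∀ k, l ≤ k → iterA T θ (d x) k = iterA T θ (d x) l := by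
    intro x
    by_cases hx : x ∈ A
    · obtain ⟨l, hl⟩ := hθ.2.2 _ (hd x hx).1
      exact ⟨l, fun _ => hl⟩
    · exact ⟨0, fun h => absurd h hx⟩
  choose L hL using hst
  obtain ⟨M, hM⟩ := (hA.image L).bddAbove
  have key : ∀ k, K ≤ k → ∀ y ∈ iterT T θ k, e.src ≤ y.src → y.tgt ≤ e.tgt →
      ∃ x ∈ A, iterA T θ (d x) k = y := by
    intro k hk
    induction k, hk using Nat.le_induction with
    | base => exact fun y hy h3 h4 => ⟨y, ⟨hy, h3, h4⟩, (hd y ⟨hy, h3, h4⟩).2⟩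
    | succ k hk ih =>
      intro y hy h3 h4
      have hmut := hθ.2.1 k
      have hy0 := hy
      simp only [iterT, iterA] at hy ⊢
      cases hθk : θ k with
      | none =>
        rw [hθk] at hy
        exact ih y hy h3 h4
      | some δ =>
        rw [hθk] at hy
        simp only [stepT, stepA, mutArc, mutate] at *
        rcases hy with ⟨h5, h6⟩ | h5
        · obtain ⟨x, hx, rfl⟩ := ih y h5 h3 h4
          exact ⟨x, hx, if_neg h6⟩
        · have hδ := hmut δ hθk
          have hcr := exchange_cross (htri k) hδ.1 (flip_spec hδ)
          have h5' : y = flipArc (iterT T θ k) δ := h5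
          rw [← h5'] at hcr
          obtain ⟨h7, h8⟩ := inside_of_cross h3 h4 ((htri k).1 δ hδ.1 e (hK k hk)) hcr
          obtain ⟨x, hx, hxe⟩ := ih δ hδ.1 h7 h8
          exact ⟨x, hx, by rw [if_pos hxe]; exact h5.symm⟩
  have hin : ∀ y ∈ iterT T θ (max K M), e.src ≤ y.src → y.tgt ≤ e.tgt → y ∈ mutSeq T θ := by
    intro y hy h3 h4
    obtain ⟨x, hx, rfl⟩ := key _ (le_max_left _ _) y hy h3 h4
    have hLM : L x ≤ M := hM ⟨x, hx, rfl⟩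
    refine (mem_mutSeq_iff hθ).2 ⟨d x, (hd x hx).1, max K M, fun k hk => ?_⟩
    rw [hL x hx k (by omega), hL x hx (max K M) (by omega)]
  refine hin γ ((htri _).2 γ fun z hz hc => ?_) h1 h2
  have hzc := Cross_symm.1 hc
  obtain ⟨h3, h4⟩ := inside_of_cross h1 h2 ((htri _).1 z hz e (hK _ (le_max_left _ _))) hzc
  exact hγ z (hin z hz h3 h4) hc

lemma generic_noncross (x : Arc) : ¬ Cross generic x := by
  have h1 := vBot_le x.src
  have h2 := le_vTop x.tgt
  unfold Cross generic; grind

lemma untouched_mem {T : Set Arc} {θ : ℕ → Option Arc}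
    (hθ : Admissible T θ) {γ : Arc} (hγ : γ ∈ T) (h : Untouched T θ γ) : γ ∈ mutSeq T θ :=
  (mem_mutSeq_iff hθ).2 ⟨γ, hγ, 0, fun k _ => h k⟩

lemma generic_untouched {T : Set Arc} (hT : IsTriangulation T) {θ : ℕ → Option Arc}
    (hθ : Admissible T θ) : Untouched T θ generic := by
  intro k
  induction k with
  | zero => rfl
  | succ k ih =>
    have hm := hθ.2.1 k
    simp only [iterA, ih]
    cases hk : θ k with
    | none => rfl
    | some δ =>
      simp only [stepA, mutArc]
      rw [if_neg]
      rintro rfl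
      have h := hm _ hk
      exact generic_noncross _ (exchange_cross (iterT_tri hT hθ k) h.1 (flip_spec h))

theorem completed_tri {T : Set Arc} (hT : IsTriangulation T) {θ : ℕ → Option Arc}
    (hθ : Admissible T θ) : IsTriangulation (completedMut T θ) := by
  refine ⟨fun x hx y hy => completed_noncross hT hθ hx hy, fun γ hγ => ?_⟩
  have hP : ∀ x ∈ mutSeq T θ ∪ pruferCompletion (mutSeq T θ), x ∈ completedMut T θ :=
    fun x hx => Or.inl hx
  rcases vtx_cases γ.src with hs | hs | ⟨a, hs⟩
  · rcases vtx_cases γ.tgt with ht | ht | ⟨b, ht⟩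
    · have := γ.lt; rw [hs, ht] at this; exact absurd this (lt_irrefl _)
    · have : γ = generic := arc_ext' hs ht
      subst this
      exact Or.inl (Or.inl (untouched_mem hθ (hT.2 _ fun x _ => generic_noncross x)
        (generic_untouched hT hθ)))
    · have : γ = adic b := arc_ext' hs ht
      exact Or.inr ⟨⟨b, this⟩, fun x hx => hγ x (hP x hx)⟩
  · have := γ.lt; rw [hs] at this; exact absurd this (not_lt.2 (le_vTop _))
  · rcases vtx_cases γ.tgt with ht | ht | ⟨b, ht⟩
    · have := γ.lt; rw [hs, ht] at this; exact absurd this (not_lt.2 (vBot_le _))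
    · have : γ = prufer a := arc_ext' hs ht
      exact Or.inl (Or.inr ⟨⟨a, this⟩, fun x hx => hγ x (hP x (Or.inl hx))⟩)
    · have hab := γ.sep a b hs ht
      obtain ⟨e, ⟨heL, het⟩, he1, he2⟩ := cover_arc {x | x ∈ mutSeq T θ ∧ x.tgt < vTop}
        (fun x hx y hy => mutSeq_noncross hT hθ hx.1 hy.1) a b hab (by
          intro c hac hcb
          have hn : prufer c ∉ pruferCompletion (mutSeq T θ) := by
            intro hn
            apply hγ _ (hP _ (Or.inr hn))
            left
            rw [hs, ht]
            exact ⟨vInt_lt.2 hac, vInt_lt.2 hcb, vInt_lt_vTop b⟩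
          have : ∃ x ∈ mutSeq T θ, Cross (prufer c) x := by
            by_contra hcon
            push Not at hcon
            exact hn ⟨⟨c, rfl⟩, hcon⟩
          obtain ⟨x, hx, hcx⟩ := this
          have := le_vTop x.tgt
          unfold Cross prufer at hcx
          refine ⟨x, ⟨hx, ?_⟩, ?_⟩ <;> grind)
      obtain ⟨e', ⟨heL', het'⟩, he1', he2'⟩ := cover_arc
        {x | x ∈ mutSeq T θ ∪ pruferCompletion (mutSeq T θ) ∧ vBot < x.src}
        (fun x hx y hy => completed_noncross hT hθ (hP x hx.1) (hP y hy.1)) a b hab (by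
          intro c hac hcb
          have hn : adic c ∉ adicCompletion' (mutSeq T θ) := by
            intro hn
            apply hγ _ (Or.inr hn)
            right
            rw [hs, ht]
            exact ⟨vBot_lt_vInt a, vInt_lt.2 hac, vInt_lt.2 hcb⟩
          have : ∃ x ∈ mutSeq T θ ∪ pruferCompletion (mutSeq T θ), Cross (adic c) x := by
            by_contra hcon
            push Not at hcon
            exact hn ⟨⟨c, rfl⟩, hcon⟩
          obtain ⟨x, hx, hcx⟩ := this
          have := vBot_le x.src
          unfold Cross adic at hcx
          refine ⟨x, ⟨hx, ?_⟩, ?_⟩ <;> grind)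
      have hper : ∃ f ∈ mutSeq T θ, vBot < f.src ∧ f.tgt < vTop ∧ f.src ≤ vInt a ∧
          vInt b ≤ f.tgt := by
        by_cases hb : vBot < e.src
        · exact ⟨e, heL, hb, het, he1, he2⟩
        · have hnc := completed_noncross hT hθ (hP e (Or.inl heL)) (hP e' heL')
          have hlt : vInt a < vInt b := vInt_lt.2 (by omega)
          have htt : e'.tgt < vTop := by
            unfold Cross at hnc
            grind
          rcases heL' with h | h
          · exact ⟨e', h, het', htt, he1', he2'⟩
          · obtain ⟨⟨k, rfl⟩, -⟩ := h
            exact absurd htt (lt_irrefl _)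
      obtain ⟨f, hf, hf1, hf2, hf3, hf4⟩ := hper
      rcases vtx_cases f.src with h | h | ⟨m, hm⟩
      · rw [h] at hf1; exact absurd hf1 (lt_irrefl _)
      · exact absurd f.lt (not_lt.2 (h ▸ le_vTop _))
      · rcases vtx_cases f.tgt with h | h | ⟨n, hn⟩
        · exact absurd f.lt (not_lt.2 (h ▸ vBot_le _))
        · rw [h] at hf2; exact absurd hf2 (lt_irrefl _)
        · exact Or.inl (Or.inl (mem_mutSeq_of_inside hT hθ hf hm hn (hs ▸ hf3) (ht ▸ hf4)
            fun x hx => hγ x (hP x (Or.inl hx))))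


/-- `e` is a first arc of `U` crossing `s`, seen from `a`. -/
def GoodFlip (s : Arc) (a : Vtx) (U : Set Arc) (e : Arc) : Prop :=
  e ∈ U ∧ Cross e s ∧ IsMutable U e ∧ ¬ Cross (flipArc U e) s ∧
    (∀ e' ∈ U, Cross e' s → Bf a e e') ∧ okU U a e.src ∧ okU U a e.tgt

/-- Pick the first crossing arc, if any. -/
noncomputable def pickArc (s : Arc) (a : Vtx) (U : Set Arc) : Option Arc :=
  if h : ∃ e, GoodFlip s a U e then some h.choose else none

lemma pickArc_some {s : Arc} {a : Vtx} {U : Set Arc} {e : Arc} (h : pickArc s a U = some e) :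
    GoodFlip s a U e := by
  unfold pickArc at h
  split_ifs at h with h'
  cases h
  exact h'.choose_spec

/-- Triangulations of the greedy sweep. -/
noncomputable def sweepT (s : Arc) (a : Vtx) (T : Set Arc) : ℕ → Set Arc
  | 0 => T
  | k + 1 => stepT (sweepT s a T k) (pickArc s a (sweepT s a T k))

/-- The greedy sweep sequence. -/
noncomputable def sweep (s : Arc) (a : Vtx) (T : Set Arc) (k : ℕ) : Option Arc :=
  pickArc s a (sweepT s a T k)

lemma iterT_sweep (s : Arc) (a : Vtx) (T : Set Arc) (k : ℕ) :
    iterT T (sweep s a T) k = sweepT s a T k := by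
  induction k with
  | zero => rfl
  | succ k ih => simp only [iterT, sweepT, ih, sweep]

lemma not_cross_self (s : Arc) : ¬ Cross s s := by
  unfold Cross; grind

theorem sweep_main {T : Set Arc} (hT : IsTriangulation T) (s : Arc) (a b : Vtx)
    (hab : (s.src = a ∧ s.tgt = b) ∨ (s.src = b ∧ s.tgt = a))
    (hfin : ∀ e ∈ T, Cross e s → {e' | e' ∈ T ∧ Cross e' s ∧ Bf a e' e}.Finite) :
    ∃ θ, Admissible T θ ∧ (∀ γ ∈ T, ¬ Cross γ s → Untouched T θ γ) ∧
      (∀ x ∈ mutSeq T θ, ¬ Cross x s) ∧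
      ({x | x ∈ T ∧ Cross x s}.Finite → s ∈ mutSeq T θ) ∧
      (∀ e ∈ T, Cross e s → ∀ x : Arc, x.src = e.src → x.tgt = a → x ∈ mutSeq T θ) := by
  set G := sweepT s a T with hG
  set θ := sweep s a T with hθdef
  have hGit : ∀ k, iterT T θ k = G k := iterT_sweep s a T
  have hGs : ∀ k, G (k + 1) = stepT (G k) (θ k) := fun k => rfl
  have hgood : ∀ k e, θ k = some e → GoodFlip s a (G k) e := fun k e h => pickArc_some h
  have htri : ∀ k, IsTriangulation (G k) := by
    intro k
    induction k with
    | zero => exact hT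
    | succ k ih =>
      rw [hGs]
      cases hk : θ k with
      | none => exact ih
      | some e => exact step_tri (hgood k e hk).2.2.1
  have hdec : ∀ k e, e ∈ G (k + 1) → Cross e s → e ∈ G k ∧ θ k ≠ some e := by
    intro k e he hc
    rw [hGs] at he
    cases hk : θ k with
    | none => rw [hk] at he; exact ⟨he, by simp⟩
    | some f =>
      rw [hk] at he
      rcases he with ⟨h1, h2⟩ | h
      · exact ⟨h1, fun h => h2 (Option.some_injective _ h).symm⟩
      · have h' : e = flipArc (G k) f := h
        rw [h'] at hc
        exact absurd hc (hgood k f hk).2.2.2.1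
  have hdec' : ∀ j k e, j ≤ k → e ∈ G k → Cross e s → e ∈ G j := by
    intro j k e hjk
    induction k, hjk using Nat.le_induction with
    | base => exact fun h _ => h
    | succ k hk ih => exact fun h hc => ih (hdec k e h hc).1 hc
  have hXT : ∀ k e, e ∈ G k → Cross e s → e ∈ T := fun k e h hc => hdec' 0 k e (Nat.zero_le _) h hc
  have hsome : ∀ k, (∃ e ∈ G k, Cross e s) → ∃ e, θ k = some e := by
    intro k hne
    obtain ⟨e, he⟩ := first_flip (htri k) s a b hab hne (fun e he hc =>
      (hfin e (hXT k e he hc) hc).subset fun x hx => ⟨hXT k x hx.1 hx.2.1, hx.2⟩)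
    have hex : ∃ e, GoodFlip s a (G k) e := ⟨e, he⟩
    exact ⟨_, dif_pos hex⟩
  have hinj : ∀ f : ℕ → Arc, (∀ k, θ k = some (f k)) → Function.Injective f := by
    have key : ∀ f : ℕ → Arc, (∀ k, θ k = some (f k)) → ∀ i j, i < j → f i ≠ f j := by
      intro f hf i j hij h
      have g := hgood j _ (hf j)
      have := hdec' (i + 1) j (f j) hij g.1 g.2.1
      exact (hdec i _ this g.2.1).2 (by rw [hf i, h])
    intro f hf i j h
    by_contra hne
    rcases lt_or_gt_of_ne hne with hlt | hlt
    · exact key f hf i j hlt h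
    · exact key f hf j i hlt h.symm
  have hgone : ∀ e ∈ T, Cross e s → ∃ k, e ∉ G k := by
    intro e he hc
    by_contra hcon
    push Not at hcon
    choose f hf using fun k => hsome k ⟨e, hcon k, hc⟩
    refine Set.infinite_of_injective_forall_mem (hinj f hf) (fun k => ?_) (hfin e he hc)
    have g := hgood k _ (hf k)
    exact ⟨hXT k _ g.1 g.2.1, g.2.1, g.2.2.2.2.1 e (hcon k) hc⟩
  have hA1 : ∀ γ k, ¬ Cross (iterA T θ γ k) s → iterA T θ γ (k + 1) = iterA T θ γ k := by
    intro γ k hc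
    simp only [iterA]
    cases hk : θ k with
    | none => rfl
    | some e =>
      simp only [stepA, mutArc]
      rw [if_neg]
      intro h
      rw [h] at hc
      exact hc (hgood k e hk).2.1
  have hA2 : ∀ γ j k, j ≤ k → ¬ Cross (iterA T θ γ j) s → iterA T θ γ k = iterA T θ γ j := by
    intro γ j k hjk hc
    induction k, hjk using Nat.le_induction with
    | base => rfl
    | succ k hk ih => rw [hA1 γ k (by rw [ih]; exact hc), ih]
  have hA3 : ∀ γ k, Cross (iterA T θ γ k) s → iterA T θ γ k = γ := by
    intro γ k
    induction k with
    | zero => intro _; rfl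
    | succ k ih =>
      intro hc
      by_cases hc' : Cross (iterA T θ γ k) s
      · have h1 := ih hc'
        revert hc
        simp only [iterA]
        cases hk : θ k with
        | none => exact fun _ => h1
        | some e =>
          simp only [stepA, mutArc]
          split_ifs with h
          · rw [hGit]
            exact fun hc => absurd hc (hgood k e hk).2.2.2.1
          · exact fun _ => h1
      · rw [hA1 γ k hc'] at hc
        exact absurd hc hc'
  have hadm : Admissible T θ := by
    refine ⟨?_, ?_, ?_⟩
    · intro i hi
      have : G (i + 1) = G i := by rw [hGs, hi]; rfl
      change pickArc s a (G (i + 1)) = none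
      rw [this]
      exact hi
    · intro i γ hi
      rw [hGit]
      exact (hgood i γ hi).2.2.1
    · intro γ _
      by_cases h : ∃ k, ¬ Cross (iterA T θ γ k) s
      · obtain ⟨l, hl⟩ := h
        exact ⟨l, fun k hk => hA2 γ l k hk hl⟩
      · push Not at h
        exact ⟨0, fun k _ => by rw [hA3 γ k (h k), hA3 γ 0 (h 0)]⟩
  have hstay : ∀ k x, x ∈ G k → ¬ Cross x s → x ∈ mutSeq T θ := by
    intro k x hx hc
    obtain ⟨γ, hγ, rfl⟩ := iterA_surj hadm k (by rw [hGit]; exact hx)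
    exact (mem_mutSeq_iff hadm).2 ⟨γ, hγ, k, fun j hj => hA2 γ k j hj hc⟩
  refine ⟨θ, hadm, ?_, ?_, ?_, ?_⟩
  · intro γ _ hc l
    exact hA2 γ 0 l (Nat.zero_le _) hc
  · intro x hx hc
    obtain ⟨l, hl⟩ := mutSeq_eventually hadm hx
    have hxk : ∀ k, x ∈ G k := by
      intro k
      have := hl (max l k) (le_max_left _ _)
      rw [hGit] at this
      exact hdec' k _ x (le_max_right _ _) this hc
    obtain ⟨k, hk⟩ := hgone x (hxk 0) hc
    exact hk (hxk k)
  · intro hXfin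
    have : ∃ k, ¬ ∃ e ∈ G k, Cross e s := by
      by_contra hcon
      push Not at hcon
      choose f hf using fun k => hsome k (hcon k)
      refine Set.infinite_of_injective_forall_mem (hinj f hf) (fun k => ?_) hXfin
      have g := hgood k _ (hf k)
      exact ⟨hXT k _ g.1 g.2.1, g.2.1⟩
    obtain ⟨k, hk⟩ := this
    push Not at hk
    exact hstay k s ((htri k).2 s fun x hx h => hk x hx (Cross_symm.1 h)) (not_cross_self s)
  · intro e he hc x hx1 hx2
    have hex := hgone e he hc
    have hnz : Nat.find hex ≠ 0 := by
      intro h0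
      have := Nat.find_spec hex
      rw [h0] at this
      exact this he
    obtain ⟨j, hj⟩ := Nat.exists_eq_succ_of_ne_zero hnz
    have hout : e ∉ G (j + 1) := by
      have := Nat.find_spec hex
      rw [hj] at this
      exact this
    have hin : e ∈ G j := by
      by_contra h
      exact Nat.find_min hex (by omega : j < Nat.find hex) h
    have hθj : θ j = some e := by
      cases hk : θ j with
      | none => rw [hGs, hk] at hout; exact absurd hin hout
      | some f =>
        by_cases hfe : e = f
        · rw [hfe]
        · rw [hGs, hk] at hout
          exact absurd (Or.inl ⟨hin, hfe⟩) hout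
    have g := hgood j e hθj
    refine hstay j x (mem_of_okU (htri j) ?_) ?_
    · rw [hx1, hx2]; exact okU_swap g.2.2.2.2.2.1
    · rw [Cross_iff_CU, hx2]
      rcases hab with ⟨h1, h2⟩ | ⟨h1, h2⟩
      · rw [h1, h2]; exact fun h => not_CU_share (CU_swap.1 h)
      · rw [h1, h2]; exact fun h => not_CU_share (CU_swap.1 (CU_swap'.1 h))


lemma finite_window (W : Set Vtx) (hW : W.Finite) :
    {x : Arc | x.src ∈ W ∧ x.tgt ∈ W}.Finite := by
  refine Set.Finite.of_finite_image (f := fun x : Arc => (x.src, x.tgt))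
    ((hW.prod hW).subset ?_) ?_
  · rintro _ ⟨x, ⟨h1, h2⟩, rfl⟩
    exact ⟨h1, h2⟩
  · intro x _ y _ h
    simp only [Prod.mk.injEq] at h
    exact arc_ext' h.1 h.2

lemma finite_win (m n : ℤ) : {v : Vtx | v = vBot ∨ v = vTop ∨ (vInt m ≤ v ∧ v ≤ vInt n)}.Finite := by
  refine ((((Set.finite_Icc m n).image vInt).insert vTop).insert vBot).subset ?_
  rintro v (h | h | ⟨h1, h2⟩)
  · exact Or.inl h
  · exact Or.inr (Or.inl h)
  · rcases vtx_cases v with rfl | rfl | ⟨k, rfl⟩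
    · exact Or.inl rfl
    · exact Or.inr (Or.inl rfl)
    · exact Or.inr (Or.inr ⟨k, ⟨vInt_le.1 h1, vInt_le.1 h2⟩, rfl⟩)

lemma Bf_nested {a : Vtx} {e e' : Arc} (h1 : e.src < a) (h2 : a < e.tgt) (h1' : e'.src < a)
    (h2' : a < e'.tgt) (h : Bf a e' e) : e.src ≤ e'.src ∧ e'.tgt ≤ e.tgt := by
  obtain ⟨hA, hB⟩ := h
  have k1 : ky a e.tgt < ky a e.src := by rw [ky_lt_iff]; exact Or.inl ⟨not_lt.2 h2.le, h1⟩
  have k2 : ky a e'.tgt < ky a e'.src := by rw [ky_lt_iff]; exact Or.inl ⟨not_lt.2 h2'.le, h1'⟩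
  rw [min_eq_right k1.le, min_eq_right k2.le] at hA
  rw [max_eq_left k1.le, max_eq_left k2.le] at hB
  constructor
  · by_contra hc
    refine absurd hB (not_le.2 ?_)
    rw [ky_lt_iff]
    exact Or.inr ⟨iff_of_true h1' h1, not_le.1 hc⟩
  · by_contra hc
    refine absurd hA (not_le.2 ?_)
    rw [ky_lt_iff]
    exact Or.inr ⟨iff_of_false (not_lt.2 h2.le) (not_lt.2 h2'.le), not_le.1 hc⟩

lemma cross_prufer {e : Arc} {N : ℤ} (h : Cross e (prufer N)) :
    e.src < vInt N ∧ vInt N < e.tgt ∧ e.tgt < vTop := by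
  have := le_vTop e.tgt
  unfold Cross prufer at h; grind

lemma cross_adic {e : Arc} {M : ℤ} (h : Cross e (adic M)) :
    vBot < e.src ∧ e.src < vInt M ∧ vInt M < e.tgt := by
  have := vBot_le e.src
  unfold Cross adic at h; grind

lemma cross_prufer_of {e : Arc} {N : ℤ} (h1 : e.src < vInt N) (h2 : vInt N < e.tgt)
    (h3 : e.tgt < vTop) : Cross e (prufer N) := by
  unfold Cross prufer; grind

lemma cross_adic_of {e : Arc} {M : ℤ} (h1 : vBot < e.src) (h2 : e.src < vInt M)
    (h3 : vInt M < e.tgt) : Cross e (adic M) := by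
  unfold Cross adic; grind

lemma far_right {T : Set Arc} (hT : IsTriangulation T) (B : ℤ) :
    ∃ N : ℤ, B ≤ N ∧ ∃ θ, Admissible T θ ∧ (∀ γ ∈ T, ¬ Cross γ (prufer N) → Untouched T θ γ) ∧
      prufer N ∈ completedMut T θ := by
  have main : ∃ N : ℤ, B ≤ N ∧ ∀ e ∈ T, Cross e (prufer N) →
      {e' | e' ∈ T ∧ Cross e' (prufer N) ∧ Bf (vInt N) e' e}.Finite := by
    by_cases hy : ∃ y, B < y ∧ adic y ∈ T
    · obtain ⟨y, hBy, hyT⟩ := hy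
      have hbot : ∀ e ∈ T, Cross e (prufer y) → e.src = vBot := by
        intro e he hc
        obtain ⟨h1, h2, h3⟩ := cross_prufer hc
        by_contra hb
        exact hT.1 e he _ hyT (cross_adic_of (lt_of_le_of_ne (vBot_le _) (Ne.symm hb)) h1 h2)
      refine ⟨y, hBy.le, fun e he hc => ?_⟩
      obtain ⟨h1, h2, h3⟩ := cross_prufer hc
      rcases vtx_cases e.tgt with ht | ht | ⟨t, ht⟩
      · rw [ht] at h2; exact absurd h2 (not_lt.2 (vBot_le _))
      · rw [ht] at h3; exact absurd h3 (lt_irrefl _)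
      refine (finite_window _ (finite_win y t)).subset ?_
      rintro e' ⟨he', hc', hb⟩
      obtain ⟨h1', h2', h3'⟩ := cross_prufer hc'
      have := Bf_nested h1 h2 h1' h2' hb
      exact ⟨Or.inl (hbot e' he' hc'), Or.inr (Or.inr ⟨h2'.le, ht ▸ this.2⟩)⟩
    · refine ⟨B, le_rfl, fun e he hc => ?_⟩
      obtain ⟨h1, h2, h3⟩ := cross_prufer hc
      rcases vtx_cases e.tgt with ht | ht | ⟨t, ht⟩
      · rw [ht] at h2; exact absurd h2 (not_lt.2 (vBot_le _))
      · rw [ht] at h3; exact absurd h3 (lt_irrefl _)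
      rcases vtx_cases e.src with hs | hs | ⟨u, hs⟩
      · refine absurd ⟨t, ?_, ?_⟩ hy
        · rw [ht, vInt_lt] at h2; exact h2
        · have : e = adic t := arc_ext' hs ht
          exact this ▸ he
      · rw [hs] at h1; exact absurd h1 (not_lt.2 (le_vTop _))
      refine (finite_inside u t).subset ?_
      rintro e' ⟨he', hc', hb⟩
      obtain ⟨h1', h2', h3'⟩ := cross_prufer hc'
      have := Bf_nested h1 h2 h1' h2' hb
      exact ⟨hs ▸ this.1, ht ▸ this.2⟩
  obtain ⟨N, hBN, hfin⟩ := main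
  obtain ⟨θ, h1, h2, h3, -, -⟩ := sweep_main hT (prufer N) (vInt N) vTop (Or.inl ⟨rfl, rfl⟩) hfin
  refine ⟨N, hBN, θ, h1, h2, Or.inl (Or.inr ⟨⟨N, rfl⟩, fun x hx hc => h3 x hx (Cross_symm.1 hc)⟩)⟩

lemma far_left {T : Set Arc} (hT : IsTriangulation T) (B N : ℤ) (hBN : B ≤ N) (hN : prufer N ∈ T) :
    ∃ M : ℤ, M ≤ B ∧ ∃ θ, Admissible T θ ∧ (∀ γ ∈ T, ¬ Cross γ (adic M) → Untouched T θ γ) ∧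
      adic M ∈ completedMut T θ := by
  have main : ∃ M : ℤ, M ≤ B ∧ ∀ e ∈ T, Cross e (adic M) →
      {e' | e' ∈ T ∧ Cross e' (adic M) ∧ Bf (vInt M) e' e}.Finite := by
    by_cases hy : ∃ y, y < B ∧ prufer y ∈ T
    · obtain ⟨y, hBy, hyT⟩ := hy
      have htop : ∀ e ∈ T, Cross e (adic y) → e.tgt = vTop := by
        intro e he hc
        obtain ⟨h1, h2, h3⟩ := cross_adic hc
        by_contra hb
        exact hT.1 e he _ hyT (cross_prufer_of h2 h3 (lt_of_le_of_ne (le_vTop _) hb))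
      refine ⟨y, hBy.le, fun e he hc => ?_⟩
      obtain ⟨h1, h2, h3⟩ := cross_adic hc
      rcases vtx_cases e.src with hs | hs | ⟨u, hs⟩
      · rw [hs] at h1; exact absurd h1 (lt_irrefl _)
      · rw [hs] at h2; exact absurd h2 (not_lt.2 (le_vTop _))
      refine (finite_window _ (finite_win u y)).subset ?_
      rintro e' ⟨he', hc', hb⟩
      obtain ⟨h1', h2', h3'⟩ := cross_adic hc'
      have := Bf_nested h2 h3 h2' h3' hb
      exact ⟨Or.inr (Or.inr ⟨hs ▸ this.1, h2'.le⟩), Or.inr (Or.inl (htop e' he' hc'))⟩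
    · refine ⟨B, le_rfl, fun e he hc => ?_⟩
      obtain ⟨h1, h2, h3⟩ := cross_adic hc
      rcases vtx_cases e.src with hs | hs | ⟨u, hs⟩
      · rw [hs] at h1; exact absurd h1 (lt_irrefl _)
      · rw [hs] at h2; exact absurd h2 (not_lt.2 (le_vTop _))
      rcases vtx_cases e.tgt with ht | ht | ⟨t, ht⟩
      · rw [ht] at h3; exact absurd h3 (not_lt.2 (vBot_le _))
      · refine absurd ⟨u, ?_, ?_⟩ hy
        · rw [hs, vInt_lt] at h2; exact h2
        · have : e = prufer u := arc_ext' hs ht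
          exact this ▸ he
      refine (finite_inside u t).subset ?_
      rintro e' ⟨he', hc', hb⟩
      obtain ⟨h1', h2', h3'⟩ := cross_adic hc'
      have := Bf_nested h2 h3 h2' h3' hb
      exact ⟨hs ▸ this.1, ht ▸ this.2⟩
  obtain ⟨M, hBM, hfin⟩ := main
  obtain ⟨θ, h1, h2, h3, h4, h5⟩ :=
    sweep_main hT (adic M) (vInt M) vBot (Or.inr ⟨rfl, rfl⟩) hfin
  refine ⟨M, hBM, θ, h1, h2, ?_⟩
  by_cases hin : adic M ∈ mutSeq T θ
  · exact Or.inl (Or.inl hin)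
  refine Or.inr ⟨⟨M, rfl⟩, ?_⟩
  rintro x (hx | hx) hc
  · exact h3 x hx (Cross_symm.1 hc)
  obtain ⟨⟨n, rfl⟩, hx⟩ := hx
  obtain ⟨-, hnM, -⟩ := cross_adic (Cross_symm.1 hc)
  change vInt n < vInt M at hnM
  by_cases hlow : ∃ e ∈ T, Cross e (adic M) ∧ e.src < vInt n
  · obtain ⟨e, he, hce, hlt⟩ := hlow
    obtain ⟨x, hx1, hx2⟩ := exists_arc hlt hnM
    refine hx x (h5 e he hce x hx1 hx2) (Cross_symm.1 (cross_prufer_of ?_ ?_ ?_))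
    · rw [hx1]; exact hlt
    · rw [hx2]; exact hnM
    · rw [hx2]; exact vInt_lt_vTop _
  · push Not at hlow
    refine hin (h4 ((finite_window _ (finite_win n (max M N))).subset ?_))
    rintro e ⟨he, hce⟩
    obtain ⟨k1, k2, k3⟩ := cross_adic hce
    have hMm : vInt M ≤ vInt (max M N) := vInt_le.2 (le_max_left _ _)
    have hNm : vInt N ≤ vInt (max M N) := vInt_le.2 (le_max_right _ _)
    refine ⟨Or.inr (Or.inr ⟨hlow e he hce, k2.le.trans hMm⟩), ?_⟩
    by_cases htop : e.tgt = vTop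
    · exact Or.inr (Or.inl htop)
    refine Or.inr (Or.inr ⟨hnM.le.trans k3.le, ?_⟩)
    by_contra hgt
    rw [not_le] at hgt
    refine hT.1 e he _ hN (cross_prufer_of ?_ (hNm.trans_lt hgt)
      (lt_of_le_of_ne (le_vTop _) htop))
    exact k2.trans_le (vInt_le.2 (hBM.trans hBN))

/-- All integer endpoints of `x` lie in `[-B, B]`. -/
def Bdd (B : ℤ) (x : Arc) : Prop :=
  ∀ m : ℤ, x.src = vInt m ∨ x.tgt = vInt m → -B ≤ m ∧ m ≤ B

lemma bdd_mono {B B' : ℤ} (h : B ≤ B') {x : Arc} (hx : Bdd B x) : Bdd B' x := by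
  intro m hm
  have := hx m hm
  omega

lemma exists_bdd_vtx (v : Vtx) : ∃ B : ℤ, ∀ m : ℤ, v = vInt m → -B ≤ m ∧ m ≤ B := by
  rcases vtx_cases v with rfl | rfl | ⟨k, rfl⟩
  · exact ⟨0, fun m h => absurd h (vBot_ne_vInt m)⟩
  · exact ⟨0, fun m h => absurd h (vTop_ne_vInt m)⟩
  · refine ⟨|k|, fun m h => ?_⟩
    rw [← vInt_inj.1 h]
    exact ⟨neg_abs_le k, le_abs_self k⟩

lemma exists_bdd (x : Arc) : ∃ B : ℤ, Bdd B x := by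
  obtain ⟨B1, h1⟩ := exists_bdd_vtx x.src
  obtain ⟨B2, h2⟩ := exists_bdd_vtx x.tgt
  refine ⟨max B1 B2, fun m hm => ?_⟩
  rcases hm with hm | hm
  · have := h1 m hm; omega
  · have := h2 m hm; omega

lemma exists_bdd_set {F : Set Arc} (hF : F.Finite) : ∃ B : ℤ, 0 ≤ B ∧ ∀ x ∈ F, Bdd B x := by
  induction F, hF using Set.Finite.induction_on with
  | empty => exact ⟨0, le_rfl, fun x hx => absurd hx (Set.notMem_empty x)⟩
  | insert _ _ ih =>
    rename_i a S _ _
    obtain ⟨B1, h0, h1⟩ := ih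
    obtain ⟨B2, h2⟩ := exists_bdd a
    refine ⟨max B1 B2, h0.trans (le_max_left _ _), ?_⟩
    rintro x (rfl | hx)
    · exact bdd_mono (le_max_right _ _) h2
    · exact bdd_mono (le_max_left _ _) (h1 x hx)

lemma bdd_not_cross_prufer {B N : ℤ} {x : Arc} (h : Bdd B x) (hN : B ≤ N) :
    ¬ Cross x (prufer N) := by
  intro hc
  obtain ⟨h1, h2, h3⟩ := cross_prufer hc
  rcases vtx_cases x.tgt with ht | ht | ⟨t, ht⟩
  · rw [ht] at h2; exact absurd h2 (not_lt.2 (vBot_le _))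
  · rw [ht] at h3; exact absurd h3 (lt_irrefl _)
  · have := h t (Or.inr ht)
    rw [ht, vInt_lt] at h2; omega

lemma bdd_not_cross_adic {B M : ℤ} {x : Arc} (h : Bdd B x) (hM : M ≤ -B) :
    ¬ Cross x (adic M) := by
  intro hc
  obtain ⟨h1, h2, h3⟩ := cross_adic hc
  rcases vtx_cases x.src with hs | hs | ⟨u, hs⟩
  · rw [hs] at h1; exact absurd h1 (lt_irrefl _)
  · rw [hs] at h2; exact absurd h2 (not_lt.2 (le_vTop _))
  · have := h u (Or.inl hs)
    rw [hs, vInt_lt] at h2; omega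

lemma mut_sub {T : Set Arc} {θ : ℕ → Option Arc} : mutSeq T θ ⊆ completedMut T θ :=
  fun _ hx => Or.inl (Or.inl hx)

lemma vtx_window {B M N : ℤ} (hM : M ≤ -B) (hN : B ≤ N) {v : Vtx}
    (h : ∀ m : ℤ, v = vInt m → -B ≤ m ∧ m ≤ B) :
    v = vBot ∨ v = vTop ∨ (vInt M ≤ v ∧ v ≤ vInt N) := by
  rcases vtx_cases v with hs | hs | ⟨u, hs⟩
  · exact Or.inl hs
  · exact Or.inr (Or.inl hs)
  · have := h u hs
    rw [hs, vInt_le, vInt_le]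
    exact Or.inr (Or.inr ⟨by omega, by omega⟩)

lemma window_of_cross {e s : Arc} {M N : ℤ} (hMN : M ≤ N) (he1 : ¬ Cross e (prufer N))
    (he2 : ¬ Cross e (adic M)) (hc : Cross e s)
    (hs1 : s.src = vBot ∨ s.src = vTop ∨ (vInt M ≤ s.src ∧ s.src ≤ vInt N))
    (hs2 : s.tgt = vBot ∨ s.tgt = vTop ∨ (vInt M ≤ s.tgt ∧ s.tgt ≤ vInt N)) :
    (e.src = vBot ∨ e.src = vTop ∨ (vInt M ≤ e.src ∧ e.src ≤ vInt N)) ∧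
    (e.tgt = vBot ∨ e.tgt = vTop ∨ (vInt M ≤ e.tgt ∧ e.tgt ≤ vInt N)) := by
  have a1 := vBot_le e.src
  have a2 := le_vTop e.tgt
  have a3 := vBot_le s.src
  have a4 := le_vTop s.tgt
  have a5 := e.lt
  have a6 := s.lt
  have a7 := vInt_le.2 hMN
  have a8 := vBot_lt_vInt M
  have a9 := vInt_lt_vTop N
  have b1 : ¬ (e.src < vInt N ∧ vInt N < e.tgt ∧ e.tgt < vTop) :=
    fun h => he1 (cross_prufer_of h.1 h.2.1 h.2.2)
  have b2 : ¬ (vBot < e.src ∧ e.src < vInt M ∧ vInt M < e.tgt) :=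
    fun h => he2 (cross_adic_of h.1 h.2.1 h.2.2)
  unfold Cross at hc
  constructor
  · by_contra hcon
    push Not at hcon
    obtain ⟨c1, c2, c3⟩ := hcon
    rcases lt_or_ge e.src (vInt M) with h | h
    · have d1 : vBot < e.src := lt_of_le_of_ne a1 (Ne.symm c1)
      have d2 : e.tgt ≤ vInt M := by
        by_contra hh
        exact b2 ⟨d1, h, not_le.1 hh⟩
      clear b1 b2 he1 he2 c1 c2 c3
      grind
    · have d := c3 h
      clear b1 b2 he1 he2 c1 c2 c3
      grind
  · by_contra hcon
    push Not at hcon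
    obtain ⟨c1, c2, c3⟩ := hcon
    rcases lt_or_ge e.tgt (vInt M) with h | h
    · clear b1 b2 he1 he2 c1 c2 c3
      grind
    · have d := c3 h
      have d1 : e.tgt < vTop := lt_of_le_of_ne a2 c2
      have d2 : vInt N ≤ e.src := by
        by_contra hh
        exact b1 ⟨not_le.1 hh, d, d1⟩
      clear b1 b2 he1 he2 c1 c2 c3
      grind

theorem K_lemma {T F : Set Arc} (hT : IsTriangulation T) (hF : F.Finite) (hFT : F ⊆ T) (s : Arc)
    (hs : ∀ f ∈ F, ¬ Cross f s) :
    ∃ θ1 θ2 θ3 : ℕ → Option Arc, Admissible T θ1 ∧ Admissible (completedMut T θ1) θ2 ∧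
      Admissible (completedMut (completedMut T θ1) θ2) θ3 ∧
      (∀ f ∈ F, Untouched T θ1 f ∧ Untouched (completedMut T θ1) θ2 f ∧
        Untouched (completedMut (completedMut T θ1) θ2) θ3 f) ∧
      insert s F ⊆ completedMut (completedMut (completedMut T θ1) θ2) θ3 ∧
      IsTriangulation (completedMut (completedMut (completedMut T θ1) θ2) θ3) := by
  obtain ⟨B, hB0, hB⟩ := exists_bdd_set (hF.insert s)
  obtain ⟨N, hBN, θ1, A1, U1, P1⟩ := far_right hT B
  have V1 : ∀ f ∈ F, Untouched T θ1 f := fun f hf =>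
    U1 f (hFT hf) (bdd_not_cross_prufer (hB f (Or.inr hf)) hBN)
  have F1 : F ⊆ completedMut T θ1 := fun f hf => mut_sub (untouched_mem A1 (hFT hf) (V1 f hf))
  have hT1 := completed_tri hT A1
  generalize hT1e : completedMut T θ1 = T1 at *
  obtain ⟨M, hMB, θ2, A2, U2, P2⟩ := far_left hT1 (-B) N (by omega) P1
  have V2 : ∀ f ∈ F, Untouched T1 θ2 f := fun f hf =>
    U2 f (F1 hf) (bdd_not_cross_adic (hB f (Or.inr hf)) hMB)
  have F2 : F ⊆ completedMut T1 θ2 := fun f hf => mut_sub (untouched_mem A2 (F1 hf) (V2 f hf))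
  have hPN : prufer N ∈ completedMut T1 θ2 := by
    refine mut_sub (untouched_mem A2 P1 (U2 _ P1 ?_))
    intro hc
    obtain ⟨h1, h2, h3⟩ := cross_adic hc
    change vInt N < vInt M at h2
    rw [vInt_lt] at h2
    omega
  have hT2 := completed_tri hT1 A2
  generalize hT2e : completedMut T1 θ2 = T2 at *
  have hfin : {e | e ∈ T2 ∧ Cross e s}.Finite := by
    refine (finite_window _ (finite_win M N)).subset ?_
    rintro e ⟨he, hc⟩
    have hbs := hB s (Or.inl rfl)
    exact window_of_cross (by omega) (hT2.1 e he _ hPN) (hT2.1 e he _ P2) hc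
      (vtx_window hMB hBN fun m hm => hbs m (Or.inl hm))
      (vtx_window hMB hBN fun m hm => hbs m (Or.inr hm))
  obtain ⟨θ3, A3, U3, -, S3, -⟩ := sweep_main hT2 s s.src s.tgt (Or.inl ⟨rfl, rfl⟩)
    (fun e _ _ => hfin.subset fun x hx => ⟨hx.1, hx.2.1⟩)
  have V3 : ∀ f ∈ F, Untouched T2 θ3 f := fun f hf => U3 f (F2 hf) (hs f hf)
  refine ⟨θ1, θ2, θ3, A1, ?_⟩
  rw [hT1e, hT2e]
  refine ⟨A2, A3, fun f hf => ⟨V1 f hf, V2 f hf, V3 f hf⟩, ?_, completed_tri hT2 A3⟩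
  rintro x (rfl | hx)
  · exact mut_sub (S3 hfin)
  · exact mut_sub (untouched_mem A3 (F2 hx) (V3 x hx))


lemma arc_countable : Countable Arc := by
  have hv : Countable Vtx := by
    exact inferInstanceAs (Countable (Option (Option ℤ)))
  exact Function.Injective.countable (f := fun x : Arc => (x.src, x.tgt)) fun x y h => by
    simp only [Prod.mk.injEq] at h
    exact arc_ext' h.1 h.2

theorem connect {T T'' : Set Arc} (hT : IsTriangulation T) (hT'' : IsTriangulation T'') :
    ∃ Γ : ℕ → Option (ℕ → Option Arc), CompAdmissible T Γ ∧ transfiniteMut T Γ = T'' := by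
  have := arc_countable
  obtain ⟨f, hf⟩ := (Set.to_countable T'').exists_eq_range
    ⟨generic, hT''.2 generic fun x _ => generic_noncross x⟩
  have hfm : ∀ j, f j ∈ T'' := fun j => hf ▸ Set.mem_range_self j
  have step : ∀ (i : ℕ) (S : Set Arc), ∃ θ1 θ2 θ3 : ℕ → Option Arc,
      IsTriangulation S → (∀ j < i, f j ∈ S) →
      (Admissible S θ1 ∧ Admissible (completedMut S θ1) θ2 ∧
      Admissible (completedMut (completedMut S θ1) θ2) θ3 ∧
      (∀ j < i, Untouched S θ1 (f j) ∧ Untouched (completedMut S θ1) θ2 (f j) ∧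
        Untouched (completedMut (completedMut S θ1) θ2) θ3 (f j)) ∧
      (∀ j < i + 1, f j ∈ completedMut (completedMut (completedMut S θ1) θ2) θ3) ∧
      IsTriangulation (completedMut (completedMut (completedMut S θ1) θ2) θ3)) := by
    intro i S
    by_cases hS : IsTriangulation S ∧ ∀ j < i, f j ∈ S
    · obtain ⟨θ1, θ2, θ3, h1, h2, h3, h4, h5, h6⟩ := K_lemma (F := f '' {j | j < i}) hS.1
        ((Set.finite_lt_nat i).image f) (by rintro _ ⟨j, hj, rfl⟩; exact hS.2 j hj) (f i)
        (by rintro _ ⟨j, hj, rfl⟩; exact hT''.1 _ (hfm j) _ (hfm i))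
      refine ⟨θ1, θ2, θ3, fun _ _ => ⟨h1, h2, h3, fun j hj => h4 _ ⟨j, hj, rfl⟩, ?_, h6⟩⟩
      intro j hj
      rcases Nat.lt_succ_iff_lt_or_eq.1 hj with hj | rfl
      · exact h5 (Or.inr ⟨j, hj, rfl⟩)
      · exact h5 (Or.inl rfl)
    · exact ⟨fun _ => none, fun _ => none, fun _ => none, fun a b => absurd ⟨a, b⟩ hS⟩
  choose t1 t2 t3 ht using step
  let C1 : ℕ → Set Arc → Set Arc := fun i S => completedMut S (t1 i S)
  let C2 : ℕ → Set Arc → Set Arc := fun i S => completedMut (C1 i S) (t2 i S)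
  let C3 : ℕ → Set Arc → Set Arc := fun i S => completedMut (C2 i S) (t3 i S)
  let St : ℕ → Set Arc := fun n => Nat.rec T (fun i S => C3 i S) n
  have hSt : ∀ i, IsTriangulation (St i) ∧ ∀ j < i, f j ∈ St i := by
    intro i
    induction i with
    | zero => exact ⟨hT, fun j hj => absurd hj (Nat.not_lt_zero j)⟩
    | succ i ih =>
      have := ht i (St i) ih.1 ih.2
      exact ⟨this.2.2.2.2.2, this.2.2.2.2.1⟩
  have H := fun i => ht i (St i) (hSt i).1 (hSt i).2
  let Γ : ℕ → Option (ℕ → Option Arc) := fun k =>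
    some (if k % 3 = 0 then t1 (k / 3) (St (k / 3)) else
      if k % 3 = 1 then t2 (k / 3) (St (k / 3)) else t3 (k / 3) (St (k / 3)))
  have g0 : ∀ i, Γ (3 * i) = some (t1 i (St i)) := by
    intro i
    have e1 : 3 * i % 3 = 0 := by omega
    have e2 : 3 * i / 3 = i := by omega
    simp only [Γ, e1, e2, if_true]
  have g1 : ∀ i, Γ (3 * i + 1) = some (t2 i (St i)) := by
    intro i
    have e1 : (3 * i + 1) % 3 = 1 := by omega
    have e2 : (3 * i + 1) / 3 = i := by omega
    simp [Γ, e1, e2]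
  have g2 : ∀ i, Γ (3 * i + 2) = some (t3 i (St i)) := by
    intro i
    have e1 : (3 * i + 2) % 3 = 2 := by omega
    have e2 : (3 * i + 2) / 3 = i := by omega
    simp [Γ, e1, e2]
  have cs : ∀ k θ, Γ k = some θ → compIter T Γ (k + 1) = completedMut (compIter T Γ k) θ := by
    intro k θ h
    simp only [compIter, h]
  have c0 : ∀ i, compIter T Γ (3 * i) = St i := by
    intro i
    induction i with
    | zero => rfl
    | succ i ih =>
      have : 3 * (i + 1) = 3 * i + 1 + 1 + 1 := by ring
      rw [this, cs _ _ (g2 i), cs _ _ (g1 i), cs _ _ (g0 i), ih]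
  have c1 : ∀ i, compIter T Γ (3 * i + 1) = C1 i (St i) := by
    intro i; rw [cs _ _ (g0 i), c0]
  have c2 : ∀ i, compIter T Γ (3 * i + 2) = C2 i (St i) := by
    intro i; rw [cs _ _ (g1 i), c1]
  have k3 : ∀ k, ∃ i, k = 3 * i ∨ k = 3 * i + 1 ∨ k = 3 * i + 2 := fun k => ⟨k / 3, by omega⟩
  have adm : CompAdmissible T Γ := by
    refine ⟨fun i h => by simp [Γ] at h, fun k θ h => ?_⟩
    obtain ⟨i, rfl | rfl | rfl⟩ := k3 k
    · rw [g0, Option.some.injEq] at h; subst h; rw [c0]; exact (H i).1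
    · rw [g1, Option.some.injEq] at h; subst h; rw [c1]; exact (H i).2.1
    · rw [g2, Option.some.injEq] at h; subst h; rw [c2]; exact (H i).2.2.1
  have unt : ∀ j k, 3 * (j + 1) ≤ k → ∀ θ, Γ k = some θ → Untouched (compIter T Γ k) θ (f j) := by
    intro j k hk θ h
    obtain ⟨i, rfl | rfl | rfl⟩ := k3 k
    · rw [g0, Option.some.injEq] at h; subst h; rw [c0]
      exact ((H i).2.2.2.1 j (by omega)).1
    · rw [g1, Option.some.injEq] at h; subst h; rw [c1]
      exact ((H i).2.2.2.1 j (by omega)).2.1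
    · rw [g2, Option.some.injEq] at h; subst h; rw [c2]
      exact ((H i).2.2.2.1 j (by omega)).2.2
  refine ⟨Γ, adm, Set.Subset.antisymm ?_ ?_⟩
  · intro γ hγ
    obtain ⟨i, hi⟩ := Set.mem_iUnion.1 hγ
    obtain ⟨hγi, hu⟩ := hi
    have stay : ∀ n, γ ∈ compIter T Γ (i + n) := by
      intro n
      induction n with
      | zero => exact hγi
      | succ n ih =>
        obtain ⟨θ, hθ⟩ : ∃ θ, Γ (i + n) = some θ := ⟨_, rfl⟩
        rw [← add_assoc, cs _ _ hθ]
        exact mut_sub (untouched_mem (adm.2 _ _ hθ) ih (hu _ (Nat.le_add_right _ _) _ hθ))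
    refine hT''.2 γ fun x hx => ?_
    rw [hf] at hx
    obtain ⟨j, rfl⟩ := hx
    have h1 := stay (2 * i + 3 * (j + 1))
    have e : i + (2 * i + 3 * (j + 1)) = 3 * (i + j + 1) := by ring
    rw [e, c0] at h1
    exact (hSt (i + j + 1)).1.1 _ h1 _ ((hSt (i + j + 1)).2 j (by omega))
  · intro x hx
    rw [hf] at hx
    obtain ⟨j, rfl⟩ := hx
    refine Set.mem_iUnion.2 ⟨3 * (j + 1), ?_, unt j⟩
    rw [c0]
    exact (hSt (j + 1)).2 j (by omega)


/-- Postcomposing a transfinite mutation with one completed mutation: if `μ_Θ(T) = T'` for a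
`T`-admissible composition of completed mutations `Θ`, and `β` is a `T'`-admissible sequence
with completed mutation `μ̄_β(T') = T''`, then there is a `T`-admissible composition of
completed mutations `Γ` with `μ_Γ(T) = T''`. -/
theorem statement19 (T T' T'' : Set Arc)
    (hT : IsTriangulation T) (hT' : IsTriangulation T')
    (Θ : ℕ → Option (ℕ → Option Arc)) (hΘ : CompAdmissible T Θ)
    (hΘT : transfiniteMut T Θ = T')
    (β : ℕ → Option Arc) (hβ : Admissible T' β) (hβT : completedMut T' β = T'') :
    ∃ Γ : ℕ → Option (ℕ → Option Arc), CompAdmissible T Γ ∧ transfiniteMut T Γ = T'' := by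
  exact connect hT (hβT ▸ completed_tri hT' hβ)
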